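/- arXiv:1604.05093 — 3 statements merged into one kernel-verified Lean document; each statement's English description precedes it below -/
import Mathlib

section
/- If f : (0,∞) → ℝ is subentropic of order two, then its derivative f' is operator monotone on (0,∞). -/
open scoped Matrix
open Matrix
open scoped ComplexOrder

noncomputable section

/-- The trace of `f` applied (by the functional calculus) to a Hermitian matrix,
computed via the eigenvalues.  Junk value `0` on non-Hermitian matrices. -/
def trFn (f : ℝ → ℝ) {d : Type} [Fintype d] [DecidableEq d] (ρ : Matrix d d ℂ) : ℝ :=
  if hρ : ρ.IsHermitian then ∑ i, f (hρ.eigenvalues i) else 0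

/-- `f` applied to a Hermitian matrix by the functional calculus (spectral theorem).
Junk value `0` on non-Hermitian matrices. -/
def matFn (f : ℝ → ℝ) {d : Type} [Fintype d] [DecidableEq d] (ρ : Matrix d d ℂ) :
    Matrix d d ℂ :=
  if hρ : ρ.IsHermitian then
    (hρ.eigenvectorUnitary : Matrix d d ℂ) *
      Matrix.diagonal (fun i => (f (hρ.eigenvalues i) : ℂ)) *
      star (hρ.eigenvectorUnitary : Matrix d d ℂ)
  else 0

/-- The partial trace over the second factor of a bipartite system `H₁ ⊗ H₂`,
where operators on `H₁ ⊗ H₂` are modelled as matrices indexed by `Fin m × Fin n`. -/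
def partialTrace {m n : ℕ} (ρ : Matrix (Fin m × Fin n) (Fin m × Fin n) ℂ) :
    Matrix (Fin m) (Fin m) ℂ :=
  Matrix.of fun i j => ∑ k : Fin n, ρ (i, k) (j, k)

/-- A convex function `f : (0,∞) → ℝ` is entropic if on every finite-dimensional
bipartite system the map `ρ ↦ -Tr f(ρ₁) + Tr f(ρ)` is convex in positive definite `ρ`,
where `ρ₁` is the partial trace of `ρ` on the first factor. -/
def IsEntropic (f : ℝ → ℝ) : Prop :=
  ConvexOn ℝ (Set.Ioi (0 : ℝ)) f ∧
  ∀ m n : ℕ,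
    ConvexOn ℝ {ρ : Matrix (Fin m × Fin n) (Fin m × Fin n) ℂ | ρ.PosDef}
      (fun ρ => - trFn f (partialTrace ρ) + trFn f ρ)

/-- A convex function `f : (0,∞) → ℝ` is subentropic of order `k` if
`G(ρ₁,…,ρ_k) = -Tr f(ρ₁+⋯+ρ_k) + Tr f(ρ₁) + ⋯ + Tr f(ρ_k)` is convex in `k`-tuples of
positive definite operators on any finite-dimensional Hilbert space. -/
def SubentropicOfOrder (f : ℝ → ℝ) (k : ℕ) : Prop :=
  ConvexOn ℝ (Set.Ioi (0 : ℝ)) f ∧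
  ∀ n : ℕ,
    ConvexOn ℝ {ρ : Fin k → Matrix (Fin n) (Fin n) ℂ | ∀ i, (ρ i).PosDef}
      (fun ρ => - trFn f (∑ i, ρ i) + ∑ i, trFn f (ρ i))

/-- A function is subentropic if it is subentropic of all orders. -/
def Subentropic (f : ℝ → ℝ) : Prop :=
  ∀ k : ℕ, SubentropicOfOrder f k

/-- Divided difference of `g`, with `g'` on the diagonal. -/
def divDiff (g : ℝ → ℝ) (x y : ℝ) : ℝ :=
  if x = y then deriv g x else (g x - g y) / (x - y)

/-- Conjugation `h ↦ U * h * U*` as a linear operator on matrices. -/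
def conjEnd {n : ℕ} (U : Matrix (Fin n) (Fin n) ℂ) :
    Module.End ℂ (Matrix (Fin n) (Fin n) ℂ) :=
  (LinearMap.mulLeft ℂ U).comp (LinearMap.mulRight ℂ (star U))

/-- Hadamard (entrywise) multiplication by a fixed matrix `L`, as a linear operator. -/
def hadamardEnd {n : ℕ} (L : Matrix (Fin n) (Fin n) ℂ) :
    Module.End ℂ (Matrix (Fin n) (Fin n) ℂ) where
  toFun h := L ⊙ h
  map_add' h₁ h₂ := Matrix.hadamard_add L h₁ h₂
  map_smul' c h := Matrix.hadamard_smul L h c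

/-- The Fréchet differential `dg(ρ)` of the matrix function induced by `g` at the
Hermitian matrix `ρ`: in a basis diagonalising `ρ` it acts as the Hadamard product
with the Löwner matrix of divided differences of `g`.  Junk value `0` at
non-Hermitian matrices. -/
def frechetDiff (g : ℝ → ℝ) {n : ℕ} (ρ : Matrix (Fin n) (Fin n) ℂ) :
    Module.End ℂ (Matrix (Fin n) (Fin n) ℂ) :=
  if hρ : ρ.IsHermitian then
    (conjEnd (hρ.eigenvectorUnitary : Matrix (Fin n) (Fin n) ℂ)).comp
      ((hadamardEnd (Matrix.of fun i j =>
          (divDiff g (hρ.eigenvalues i) (hρ.eigenvalues j) : ℂ))).comp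
        (conjEnd (star (hρ.eigenvectorUnitary : Matrix (Fin n) (Fin n) ℂ))))
  else 0

/-- The order, with respect to the trace inner product, between operators on `B(H)`:
`T ≤ S` iff `S - T` is a positive superoperator. -/
def endLE {n : ℕ} (T S : Module.End ℂ (Matrix (Fin n) (Fin n) ℂ)) : Prop :=
  ∀ h : Matrix (Fin n) (Fin n) ℂ, 0 ≤ Matrix.trace (star h * (S h - T h))

/-- The harmonic mean `H₂(A,B) = 2 (A⁻¹ + B⁻¹)⁻¹` of two (positive definite, hence
invertible) operators on `B(H)`. -/
def harmonicMeanEnd {n : ℕ} (A B : Module.End ℂ (Matrix (Fin n) (Fin n) ℂ)) :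
    Module.End ℂ (Matrix (Fin n) (Fin n) ℂ) :=
  (2 : ℂ) • Ring.inverse (Ring.inverse A + Ring.inverse B)

/-- The amplification `id_n ⊗ Φ` of a linear map on matrices. -/
def amplify {m k : ℕ} (Φ : Matrix (Fin m) (Fin m) ℂ →ₗ[ℂ] Matrix (Fin k) (Fin k) ℂ)
    (n : ℕ) (A : Matrix (Fin n × Fin m) (Fin n × Fin m) ℂ) :
    Matrix (Fin n × Fin k) (Fin n × Fin k) ℂ :=
  Matrix.of fun p q => Φ (Matrix.of fun x y => A (p.1, x) (q.1, y)) p.2 q.2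

/-- A linear map on matrices is completely positive if all its amplifications
preserve positive semidefiniteness. -/
def IsCompletelyPositive {m k : ℕ}
    (Φ : Matrix (Fin m) (Fin m) ℂ →ₗ[ℂ] Matrix (Fin k) (Fin k) ℂ) : Prop :=
  ∀ n : ℕ, ∀ A : Matrix (Fin n × Fin m) (Fin n × Fin m) ℂ,
    A.PosSemidef → (amplify Φ n A).PosSemidef

/-- A quantum channel is a completely positive trace preserving linear map. -/
def IsQuantumChannel {m k : ℕ}
    (Φ : Matrix (Fin m) (Fin m) ℂ →ₗ[ℂ] Matrix (Fin k) (Fin k) ℂ) : Prop :=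
  IsCompletelyPositive Φ ∧ ∀ A, (Φ A).trace = A.trace

/-- If a sum of two convex functions is differentiable at an interior point, then so is the first
summand. -/
lemma ConvexOn.differentiableAt_of_add {S : Set ℝ} {F H : ℝ → ℝ} {x : ℝ} (hF : ConvexOn ℝ S F)
    (hH : ConvexOn ℝ S H) (hx : x ∈ interior S) (hd : DifferentiableAt ℝ (F + H) x) :
    DifferentiableAt ℝ F x := by
  have hFr := hF.hasDerivWithinAt_rightDeriv_of_mem_interior hx
  have hFl := hF.hasDerivWithinAt_leftDeriv_of_mem_interior hx
  have hr := (uniqueDiffWithinAt_Ioi x).eq_deriv _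
    (hFr.add (hH.hasDerivWithinAt_rightDeriv_of_mem_interior hx)) hd.hasDerivAt.hasDerivWithinAt
  have hl := (uniqueDiffWithinAt_Iio x).eq_deriv _
    (hFl.add (hH.hasDerivWithinAt_leftDeriv_of_mem_interior hx)) hd.hasDerivAt.hasDerivWithinAt
  have hFle := hF.leftDeriv_le_rightDeriv_of_mem_interior hx
  have hHle := hH.leftDeriv_le_rightDeriv_of_mem_interior hx
  have heq : derivWithin F (Set.Iio x) x = derivWithin F (Set.Ioi x) x := by linarith
  rw [heq] at hFl
  have := (hasDerivWithinAt_Iio_iff_Iic.mp hFl).union (hasDerivWithinAt_Ioi_iff_Ici.mp hFr)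
  rw [Set.Iic_union_Ici, hasDerivWithinAt_univ] at this
  exact this.differentiableAt

/-- The differentiability points of a convex function on an open set are dense in that set. -/
lemma ConvexOn.exists_differentiableAt {S U : Set ℝ} {f : ℝ → ℝ} (hS : IsOpen S)
    (hf : ConvexOn ℝ S f) (hU : IsOpen U) (hSU : (S ∩ U).Nonempty) :
    ∃ x ∈ S ∩ U, DifferentiableAt ℝ f x := by
  obtain ⟨y, hyS, hyU⟩ := hSU
  obtain ⟨K, t, ht, hK⟩ := hf.locallyLipschitzOn hS hyS
  rw [hS.nhdsWithin_eq hyS] at ht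
  have hopen : IsOpen (interior t ∩ (S ∩ U)) := isOpen_interior.inter (hS.inter hU)
  obtain ⟨x, ⟨hxt, hxSU⟩, hx⟩ :=
    (MeasureTheory.Measure.dense_of_ae hK.ae_differentiableWithinAt_of_mem_real).inter_open_nonempty
      _ hopen ⟨y, mem_interior_iff_mem_nhds.mpr ht, hyS, hyU⟩
  exact ⟨x, hxSU, (hx (interior_subset hxt)).differentiableAt (mem_interior_iff_mem_nhds.mp hxt)⟩

/-- The tangent line inequality for a convex function. -/
lemma ConvexOn.sub_mul_deriv_le {S : Set ℝ} {f : ℝ → ℝ} {x y : ℝ} (hf : ConvexOn ℝ S f)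
    (hx : x ∈ S) (hy : y ∈ S) (hd : DifferentiableAt ℝ f y) :
    (x - y) * deriv f y ≤ f x - f y := by
  rcases lt_trichotomy x y with h | rfl | h
  · have := hf.slope_le_of_hasDerivAt hx hy h hd.hasDerivAt
    rw [slope_def_field, div_le_iff₀ (by linarith)] at this
    linarith
  · simp
  · have := hf.le_slope_of_hasDerivAt hy hx h hd.hasDerivAt
    rw [slope_def_field, le_div_iff₀ (by linarith)] at this
    linarith

/-- A differentiable convex function on an open set has continuous derivative. -/
lemma ConvexOn.continuousAt_deriv {S : Set ℝ} {f : ℝ → ℝ} {a : ℝ} (hS : IsOpen S)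
    (hf : ConvexOn ℝ S f) (hd : ∀ x ∈ S, DifferentiableAt ℝ f x) (ha : a ∈ S) :
    ContinuousAt (deriv f) a := by
  have hslope := hasDerivAt_iff_tendsto_slope.mp (hd a ha).hasDerivAt
  have hSa : S ∈ nhds a := hS.mem_nhds ha
  have hcont {y : ℝ} (hy : y ≠ a) : ContinuousAt (fun x => slope f y x) a := by
    simp only [slope_def_field]
    exact ((hd a ha).continuousAt.sub continuousAt_const).div
      (continuousAt_id.sub continuousAt_const) (sub_ne_zero.mpr hy.symm)
  refine tendsto_order.mpr ⟨fun b hb => ?_, fun b hb => ?_⟩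
  · have h1 := (hslope.mono_left (nhdsLT_le_nhdsNE a)).eventually_const_lt hb
    obtain ⟨y, ⟨hyb, hya⟩, hyS⟩ := ((h1.and self_mem_nhdsWithin).and
      (mem_nhdsWithin_of_mem_nhds hSa)).exists
    have hya : y < a := hya
    have h2 : ∀ᶠ x in nhds a, b < slope f y x :=
      (hcont hya.ne).eventually_const_lt (by simpa only [slope_comm f y a] using hyb)
    filter_upwards [h2, hSa, lt_mem_nhds hya] with x hx hxS hyx
    exact hx.trans_le (hf.slope_le_of_hasDerivAt hyS hxS hyx (hd x hxS).hasDerivAt)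
  · have h1 := (hslope.mono_left (nhdsGT_le_nhdsNE a)).eventually_lt_const hb
    obtain ⟨y, ⟨hyb, hya⟩, hyS⟩ := ((h1.and self_mem_nhdsWithin).and
      (mem_nhdsWithin_of_mem_nhds hSa)).exists
    have hya : a < y := hya
    have h2 : ∀ᶠ x in nhds a, slope f y x < b :=
      (hcont hya.ne').eventually_lt_const (by simpa only [slope_comm f y a] using hyb)
    filter_upwards [h2, hSa, gt_mem_nhds hya] with x hx hxS hyx
    rw [slope_comm] at hx
    exact (hf.le_slope_of_hasDerivAt hxS hyS hyx (hd x hxS).hasDerivAt).trans_lt hx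

/-- A convex function on the half-line all of whose increments `f - f (· + s)` are convex is
differentiable. -/
lemma differentiableAt_of_convexOn_sub_shift {f : ℝ → ℝ} (hf : ConvexOn ℝ (Set.Ioi 0) f)
    (hs : ∀ s > 0, ConvexOn ℝ (Set.Ioi 0) fun x => f x - f (x + s)) {y : ℝ} (hy : 0 < y) :
    DifferentiableAt ℝ f y := by
  obtain ⟨x, ⟨hx0, hxy⟩, hx⟩ := hf.exists_differentiableAt isOpen_Ioi (U := Set.Iio y) isOpen_Iio
    ⟨y / 2, half_pos hy, half_lt_self hy⟩
  have hx0 : 0 < x := hx0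
  have hxy : x < y := hxy
  have hshift : ConvexOn ℝ (Set.Ioi 0) fun z => f (z + (y - x)) :=
    (hf.translate_left (y - x)).subset (fun z (hz : 0 < z) => show 0 < y - x + z by linarith)
      (convex_Ioi 0)
  have hadd : (fun z => f (z + (y - x))) + (fun z => f z - f (z + (y - x))) = f := by
    ext z
    simp
  have := hshift.differentiableAt_of_add (hs (y - x) (by linarith))
    (by rwa [interior_Ioi]) (by rwa [hadd])
  rw [differentiableAt_comp_add_const] at this
  simpa using this

section FunctionalCalculus

variable {d : Type} [Fintype d] [DecidableEq d]

lemma Matrix.IsHermitian.matFn_eq_cfc {A : Matrix d d ℂ} (hA : A.IsHermitian) (h : ℝ → ℝ) :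
    matFn h A = cfc h A := by
  rw [hA.cfc_eq, matFn, dif_pos hA]
  simp only [Matrix.IsHermitian.cfc, Unitary.conjStarAlgAut_apply]
  rfl

lemma matFn_isHermitian {A : Matrix d d ℂ} (h : ℝ → ℝ) : (matFn h A).IsHermitian := by
  by_cases hA : A.IsHermitian
  · rw [hA.matFn_eq_cfc]
    exact cfc_predicate h A
  · rw [matFn, dif_neg hA]
    exact isHermitian_zero

/-- The functional calculus of an affine function of a Hermitian matrix. -/
lemma Matrix.IsHermitian.matFn_smul_add_smul_one {A : Matrix d d ℂ} (hA : A.IsHermitian)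
    (h : ℝ → ℝ) (a b : ℝ) : matFn h (a • A + b • 1) = matFn (fun x => h (a * x + b)) A := by
  have hA' : IsSelfAdjoint A := hA
  have haff : cfc (fun x : ℝ => a * x + b) A = a • A + b • 1 := by
    rw [cfc_add_const b (fun x : ℝ => a * x) A, cfc_const_mul_id a A,
      Algebra.algebraMap_eq_smul_one]
  have hB : (a • A + b • 1).IsHermitian := haff ▸ cfc_predicate _ A
  rw [hB.matFn_eq_cfc, hA.matFn_eq_cfc, ← haff]
  exact (cfc_comp' h _ A ((finite_real_spectrum.image _).continuousOn h)).symm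

/-- The diagonal of `X` in an eigenbasis of the Hermitian matrix `A`. -/
def Matrix.IsHermitian.eigenDiag {A : Matrix d d ℂ} (hA : A.IsHermitian) (X : Matrix d d ℂ)
    (j : d) : ℝ :=
  (((hA.eigenvectorUnitary : Matrix d d ℂ)ᴴ * X * (hA.eigenvectorUnitary : Matrix d d ℂ)) j j).re

namespace Matrix.IsHermitian

variable {A B : Matrix d d ℂ} (hA : A.IsHermitian) (hB : B.IsHermitian)

lemma eigenDiag_sub (X Y : Matrix d d ℂ) (j : d) :
    hA.eigenDiag (X - Y) j = hA.eigenDiag X j - hA.eigenDiag Y j := by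
  simp [eigenDiag, mul_sub, sub_mul]

lemma eigenDiag_nonneg {X : Matrix d d ℂ} (hX : X.PosSemidef) (j : d) : 0 ≤ hA.eigenDiag X j :=
  (Complex.le_def.mp (hX.conjTranspose_mul_mul_same _).diag_nonneg).1

lemma re_trace_mul_matFn (X : Matrix d d ℂ) (h : ℝ → ℝ) :
    (trace (X * matFn h A)).re = ∑ j, hA.eigenDiag X j * h (hA.eigenvalues j) := by
  rw [matFn, dif_pos hA, ← mul_assoc, ← mul_assoc, trace_mul_comm, ← mul_assoc, ← mul_assoc,
    star_eq_conjTranspose, trace, Complex.re_sum]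
  refine Finset.sum_congr rfl fun j _ => ?_
  rw [diag_apply, mul_diagonal, Complex.re_mul_ofReal, eigenDiag]

lemma conj_eigenvectorUnitary : (hA.eigenvectorUnitary : Matrix d d ℂ)ᴴ * A *
    (hA.eigenvectorUnitary : Matrix d d ℂ) = diagonal fun i => (hA.eigenvalues i : ℂ) := by
  have := hA.conjStarAlgAut_star_eigenvectorUnitary
  simpa [Unitary.conjStarAlgAut_apply, star_eq_conjTranspose, Function.comp_def] using this

lemma eigenDiag_self (j : d) : hA.eigenDiag A j = hA.eigenvalues j := by
  simp [eigenDiag, conj_eigenvectorUnitary]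

lemma eigenDiag_one (j : d) : hA.eigenDiag 1 j = 1 := by
  have : (hA.eigenvectorUnitary : Matrix d d ℂ)ᴴ * (hA.eigenvectorUnitary : Matrix d d ℂ) = 1 :=
    Unitary.coe_star_mul_self hA.eigenvectorUnitary
  simp [eigenDiag, this]

lemma eigenDiag_smul (c : ℝ) (X : Matrix d d ℂ) (j : d) :
    hA.eigenDiag (c • X) j = c * hA.eigenDiag X j := by
  simp [eigenDiag]

lemma sum_eigenDiag (X : Matrix d d ℂ) : ∑ j, hA.eigenDiag X j = (trace X).re := by
  have : matFn (fun _ => 1) A = 1 := by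
    rw [hA.matFn_eq_cfc]
    exact cfc_const_one ℝ A hA
  simpa [this] using (hA.re_trace_mul_matFn X fun _ => 1).symm

/-- Lower bounds for a Hermitian matrix are lower bounds for its eigenvalues. -/
lemma le_eigenvalues {m : ℝ} (hm : (A - m • 1).PosSemidef) (j : d) : m ≤ hA.eigenvalues j := by
  have := hA.eigenDiag_nonneg hm j
  rw [eigenDiag_sub, eigenDiag_smul, eigenDiag_self, eigenDiag_one] at this
  linarith

/-- The eigenvalues of `A` are mixed by a doubly stochastic matrix to give the diagonal of `A` in
an eigenbasis of `B`. -/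
lemma exists_doublyStochastic : ∃ P : d → d → ℝ, (∀ i j, 0 ≤ P i j) ∧ (∀ i, ∑ j, P i j = 1) ∧
    (∀ j, ∑ i, P i j = 1) ∧ ∀ j, hB.eigenDiag A j = ∑ i, P i j * hA.eigenvalues i := by
  set U : Matrix d d ℂ := ↑hA.eigenvectorUnitary with hU
  set V : Matrix d d ℂ := ↑hB.eigenvectorUnitary with hV
  set W : Matrix d d ℂ := Uᴴ * V with hW
  have hWU : W ∈ unitaryGroup d ℂ :=
    (star hA.eigenvectorUnitary * hB.eigenvectorUnitary).2
  have hconj : Vᴴ * A * V = Wᴴ * (diagonal fun i => (hA.eigenvalues i : ℂ)) * W := by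
    have hUU : U * Uᴴ = 1 := Unitary.coe_mul_star_self hA.eigenvectorUnitary
    rw [← hA.conj_eigenvectorUnitary, hW, conjTranspose_mul, conjTranspose_conjTranspose, ← hU]
    simp only [mul_assoc]
    rw [← mul_assoc U Uᴴ V, hUU, one_mul, ← mul_assoc U Uᴴ (A * V), hUU, one_mul]
  refine ⟨fun i j => Complex.normSq (W i j), fun i j => Complex.normSq_nonneg _, fun i => ?_,
    fun j => ?_, fun j => ?_⟩
  · have := congr_fun₂ (mem_unitaryGroup_iff.mp hWU) i i
    rw [mul_apply, one_apply_eq] at this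
    apply Complex.ofReal_injective
    push_cast
    rw [← this]
    simp [Complex.mul_conj]
  · have := congr_fun₂ (mem_unitaryGroup_iff'.mp hWU) j j
    rw [mul_apply, one_apply_eq] at this
    apply Complex.ofReal_injective
    push_cast
    rw [← this]
    simp [Complex.normSq_eq_conj_mul_self]
  · rw [eigenDiag, ← hV, hconj, mul_apply, Complex.re_sum]
    refine Finset.sum_congr rfl fun i _ => ?_
    rw [mul_diagonal, mul_right_comm, Complex.re_mul_ofReal, conjTranspose_apply]
    congr 1
    simp [Complex.normSq_apply]

lemma trFn_eq (f : ℝ → ℝ) : trFn f A = ∑ i, f (hA.eigenvalues i) := dif_pos hA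

/-- **Klein's inequality**: the tangent inequality for trace functions of a convex function. -/
lemma klein_inequality {S : Set ℝ} {f : ℝ → ℝ} (hf : ConvexOn ℝ S f)
    (hd : ∀ x ∈ S, DifferentiableAt ℝ f x) (hAS : ∀ i, hA.eigenvalues i ∈ S)
    (hBS : ∀ i, hB.eigenvalues i ∈ S) :
    (trace ((A - B) * matFn (deriv f) B)).re ≤ trFn f A - trFn f B := by
  obtain ⟨P, hP, hrow, hcol, hdiag⟩ := exists_doublyStochastic hA hB
  have hfA : trFn f A = ∑ j, ∑ i, P i j * f (hA.eigenvalues i) := by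
    rw [hA.trFn_eq, Finset.sum_comm]
    simp [← Finset.sum_mul, hrow]
  rw [hB.re_trace_mul_matFn, hfA, hB.trFn_eq, ← Finset.sum_sub_distrib]
  refine Finset.sum_le_sum fun j _ => ?_
  calc hB.eigenDiag (A - B) j * deriv f (hB.eigenvalues j)
      = ∑ i, P i j * ((hA.eigenvalues i - hB.eigenvalues j) * deriv f (hB.eigenvalues j)) := by
        rw [eigenDiag_sub, eigenDiag_self, hdiag]
        simp only [← mul_assoc, mul_sub, ← Finset.sum_mul, Finset.sum_sub_distrib, hcol, one_mul]
    _ ≤ ∑ i, P i j * (f (hA.eigenvalues i) - f (hB.eigenvalues j)) :=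
        Finset.sum_le_sum fun i _ => mul_le_mul_of_nonneg_left
          (hf.sub_mul_deriv_le (hAS i) (hBS j) (hd _ (hBS j))) (hP i j)
    _ = ∑ i, P i j * f (hA.eigenvalues i) - f (hB.eigenvalues j) := by
        simp only [mul_sub, Finset.sum_sub_distrib, ← Finset.sum_mul, hcol, one_mul]

/-- Every Hermitian matrix is dominated by a positive multiple of the identity. -/
lemma exists_smul_one_sub_posSemidef (hA : A.IsHermitian) :
    ∃ K : ℝ, 0 < K ∧ (K • (1 : Matrix d d ℂ) - A).PosSemidef := by
  set K : ℝ := 1 + ∑ i, |hA.eigenvalues i|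
  have hK : ∀ i, 0 ≤ K - hA.eigenvalues i := fun i => by
    have := Finset.single_le_sum (f := fun i => |hA.eigenvalues i|) (fun i _ => abs_nonneg _)
      (Finset.mem_univ i)
    have := le_abs_self (hA.eigenvalues i)
    simp only [K]
    linarith
  refine ⟨K, by positivity, ?_⟩
  have hsub : K • (1 : Matrix d d ℂ) - A = matFn (fun x => -1 * x + K) A := by
    have hneg : K • (1 : Matrix d d ℂ) - A = (-1 : ℝ) • A + K • 1 := by
      rw [neg_one_smul, neg_add_eq_sub]
    have hKA : (K • (1 : Matrix d d ℂ) - A).IsHermitian :=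
      (isHermitian_one.smul (IsSelfAdjoint.all K)).sub hA
    rw [← hA.matFn_smul_add_smul_one (fun x => x), ← hneg, hKA.matFn_eq_cfc]
    exact (cfc_id' ℝ _ hKA).symm
  rw [hsub, matFn, dif_pos hA]
  refine PosSemidef.mul_mul_conjTranspose_same (PosSemidef.diagonal fun i => ?_) _
  simpa [neg_add_eq_sub] using hK i

end Matrix.IsHermitian

end FunctionalCalculus

/-- The increments `ρ ↦ Tr f(ρ) - Tr f(ρ + τ)` of a function subentropic of order two are convex. -/
lemma SubentropicOfOrder.trFn_sub_shift_convex {f : ℝ → ℝ} (hf : SubentropicOfOrder f 2) {n : ℕ}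
    {ρ₁ ρ₂ τ : Matrix (Fin n) (Fin n) ℂ} (h₁ : ρ₁.PosDef) (h₂ : ρ₂.PosDef) (hτ : τ.PosDef)
    {a b : ℝ} (ha : 0 ≤ a) (hb : 0 ≤ b) (hab : a + b = 1) :
    trFn f (a • ρ₁ + b • ρ₂) - trFn f (a • ρ₁ + b • ρ₂ + τ) ≤
      a * (trFn f ρ₁ - trFn f (ρ₁ + τ)) + b * (trFn f ρ₂ - trFn f (ρ₂ + τ)) := by
  have hmem {σ : Matrix (Fin n) (Fin n) ℂ} (hσ : σ.PosDef) : ∀ i, (![σ, τ] i).PosDef :=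
    Fin.forall_fin_two.mpr ⟨hσ, hτ⟩
  have := (hf.2 n).2 (hmem h₁) (hmem h₂) ha hb hab
  have hτ' : a • τ + b • τ = τ := by rw [← add_smul, hab, one_smul]
  simp only [Fin.sum_univ_two, Pi.add_apply, Pi.smul_apply, cons_val_zero, cons_val_one, hτ',
    smul_eq_mul] at this
  have hfτ : a * trFn f τ + b * trFn f τ = trFn f τ := by rw [← add_mul, hab, one_mul]
  linarith

lemma trFn_smul_one_fin_one (f : ℝ → ℝ) (x : ℝ) :
    trFn f (x • (1 : Matrix (Fin 1) (Fin 1) ℂ)) = f x := by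
  have hx : (x • (1 : Matrix (Fin 1) (Fin 1) ℂ)).IsHermitian :=
    isHermitian_one.smul (IsSelfAdjoint.all x)
  have htr : hx.eigenvalues 0 = x := by
    simpa using (congr_arg Complex.re hx.trace_eq_sum_eigenvalues).symm
  rw [hx.trFn_eq, Fin.sum_univ_one, htr]

lemma SubentropicOfOrder.differentiableAt {f : ℝ → ℝ} (hf : SubentropicOfOrder f 2) :
    ∀ x ∈ Set.Ioi (0 : ℝ), DifferentiableAt ℝ f x := by
  refine fun x hx => differentiableAt_of_convexOn_sub_shift hf.1 (fun s hs => ⟨convex_Ioi 0, ?_⟩) hx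
  intro x hx y hy a b ha hb hab
  have := hf.trFn_sub_shift_convex (n := 1) (PosDef.one.smul (Set.mem_Ioi.mp hx))
    (PosDef.one.smul (Set.mem_Ioi.mp hy)) (PosDef.one.smul hs) ha hb hab
  simpa only [smul_smul, ← add_smul, trFn_smul_one_fin_one, smul_eq_mul] using this

section OperatorMonotone

variable {n : ℕ} {f : ℝ → ℝ} {ρ σ X : Matrix (Fin n) (Fin n) ℂ}

/-- A form of operator concavity of `f'`, tested against a positive definite matrix `X`, along a
segment ending near `σ`. -/
lemma SubentropicOfOrder.le_re_trace_mul_matFn_deriv (hf : SubentropicOfOrder f 2)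
    (hρ : ρ.PosDef) (hσ : σ.PosDef) (hX : X.PosDef) (hρσ : (σ - ρ).PosSemidef)
    {c : ℝ} (hc₀ : 0 < c) (hc₁ : c < 1) :
    c * (trace (X * matFn (deriv f) ρ)).re + (1 - c) * (deriv f 1 * (trace X).re) ≤
      (trace (X * matFn (deriv f) (c • σ + (2 * (1 - c)) • 1))).re := by
  have hd := hf.differentiableAt
  have hc : 0 < 1 - c := sub_pos.mpr hc₁
  obtain ⟨K, hK, hKX⟩ := hX.isHermitian.exists_smul_one_sub_posSemidef
  set t : ℝ := (1 - c) / K with ht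
  have ht₀ : 0 < t := div_pos hc hK
  have htX : (t • X).PosDef := hX.smul ht₀
  have hbound : ((1 - c) • (1 : Matrix (Fin n) (Fin n) ℂ) - t • X).PosSemidef := by
    have := hKX.smul ht₀.le
    rwa [smul_sub, smul_smul, ht, div_mul_cancel₀ _ hK.ne'] at this
  set T : Matrix (Fin n) (Fin n) ℂ := c • σ + (2 * (1 - c)) • 1 with hT
  set τ : Matrix (Fin n) (Fin n) ℂ := (1 - c)⁻¹ • (T - t • X - c • ρ) with hτ
  have hτ₁ : (τ - (1 : ℝ) • 1).PosSemidef := by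
    have h : τ - (1 : ℝ) • 1 = (1 - c)⁻¹ • (c • (σ - ρ) + ((1 - c) • 1 - t • X)) := by
      have h1 : (1 : ℝ) • (1 : Matrix (Fin n) (Fin n) ℂ) = (1 - c)⁻¹ • (1 - c) • 1 := by
        rw [smul_smul, inv_mul_cancel₀ hc.ne']
      rw [h1, hτ, hT, ← smul_sub]
      module
    rw [h]
    exact ((hρσ.smul hc₀.le).add hbound).smul (inv_pos.mpr hc).le
  have hτ₀ : τ.PosDef := by
    simpa using (PosDef.one (n := Fin n) (R := ℂ)).add_posSemidef hτ₁
  have hcomb : c • ρ + (1 - c) • τ = T - t • X := by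
    rw [hτ, smul_smul, mul_inv_cancel₀ hc.ne']
    module
  have hTX : (T - t • X).PosDef := hcomb ▸ (hρ.smul hc₀).add (hτ₀.smul hc)
  have hTpos : T.PosDef := (hσ.smul hc₀).add (PosDef.one.smul (by positivity))
  have hconv := hf.trFn_sub_shift_convex hρ hτ₀ htX hc₀.le hc.le (by ring)
  rw [hcomb, sub_add_cancel] at hconv
  have klein {A B : Matrix (Fin n) (Fin n) ℂ} (hA : A.PosDef) (hB : B.PosDef) :=
    IsHermitian.klein_inequality hA.isHermitian hB.isHermitian hf.1 hd hA.eigenvalues_pos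
      hB.eigenvalues_pos
  have kT := klein hTX hTpos
  have kρ := klein (hρ.add htX) hρ
  have kτ := klein (hτ₀.add htX) hτ₀
  simp only [sub_sub_cancel_left, add_sub_cancel_left, neg_mul, trace_neg, smul_mul_assoc,
    trace_smul, Complex.neg_re, Complex.real_smul, Complex.re_ofReal_mul] at kT kρ kτ
  have hτX : deriv f 1 * (trace X).re ≤ (trace (X * matFn (deriv f) τ)).re := by
    rw [hτ₀.isHermitian.re_trace_mul_matFn, ← hτ₀.isHermitian.sum_eigenDiag, mul_comm,
      Finset.sum_mul]
    exact Finset.sum_le_sum fun j _ => mul_le_mul_of_nonneg_left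
      (hf.1.monotoneOn_deriv hd (Set.mem_Ioi.mpr one_pos) (hτ₀.eigenvalues_pos j)
        (hτ₀.isHermitian.le_eigenvalues hτ₁ j))
      (hτ₀.isHermitian.eigenDiag_nonneg hX.posSemidef j)
  have h₁ := mul_le_mul_of_nonneg_left kρ hc₀.le
  have h₂ := mul_le_mul_of_nonneg_left
    ((mul_le_mul_of_nonneg_left hτX ht₀.le).trans kτ) hc.le
  refine le_of_mul_le_mul_left ?_ ht₀
  linarith

lemma SubentropicOfOrder.re_trace_mul_matFn_deriv_mono (hf : SubentropicOfOrder f 2)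
    (hρ : ρ.PosDef) (hσ : σ.PosDef) (hX : X.PosDef) (hρσ : (σ - ρ).PosSemidef) :
    (trace (X * matFn (deriv f) ρ)).re ≤ (trace (X * matFn (deriv f) σ)).re := by
  have hlim : Filter.Tendsto (fun c : ℝ =>
      (trace (X * matFn (deriv f) (c • σ + (2 * (1 - c)) • 1))).re) (nhdsWithin 1 (Set.Iio 1))
      (nhds (trace (X * matFn (deriv f) σ)).re) := by
    simp only [hσ.isHermitian.matFn_smul_add_smul_one, hσ.isHermitian.re_trace_mul_matFn]
    refine tendsto_finsetSum _ fun j _ => Filter.Tendsto.const_mul _ ?_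
    have hcont := hf.1.continuousAt_deriv isOpen_Ioi hf.differentiableAt (hσ.eigenvalues_pos j)
    refine hcont.tendsto.comp (tendsto_nhdsWithin_of_tendsto_nhds ?_)
    refine Continuous.tendsto' (by fun_prop) _ _ (by simp)
  have hlim' : Filter.Tendsto (fun c : ℝ => c * (trace (X * matFn (deriv f) ρ)).re +
      (1 - c) * (deriv f 1 * (trace X).re)) (nhdsWithin 1 (Set.Iio 1))
      (nhds (trace (X * matFn (deriv f) ρ)).re) :=
    tendsto_nhdsWithin_of_tendsto_nhds (Continuous.tendsto' (by fun_prop) _ _ (by simp))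
  refine le_of_tendsto_of_tendsto hlim' hlim ?_
  filter_upwards [Ioo_mem_nhdsLT (zero_lt_one' ℝ)] with c hc
  exact hf.le_re_trace_mul_matFn_deriv hρ hσ hX hρσ hc.1 hc.2

end OperatorMonotone

/-- A Hermitian matrix is positive semidefinite as soon as its trace pairings with positive definite
matrices are nonnegative. -/
lemma Matrix.IsHermitian.posSemidef_of_re_trace_mul_nonneg {d : Type} [Fintype d] [DecidableEq d]
    {M : Matrix d d ℂ} (hM : M.IsHermitian)
    (h : ∀ X : Matrix d d ℂ, X.PosDef → 0 ≤ (trace (X * M)).re) : M.PosSemidef := by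
  refine .of_dotProduct_mulVec_nonneg hM fun v => ?_
  refine Complex.le_def.mpr ⟨?_, (hM.im_star_dotProduct_mulVec_self v).symm⟩
  have hv : (trace (vecMulVec v (star v) * M)).re = (star v ⬝ᵥ M *ᵥ v).re := by
    rw [trace_mul_comm, mul_vecMulVec, trace_vecMulVec, dotProduct_comm]
  have hlim : Filter.Tendsto (fun ε : ℝ => (trace ((vecMulVec v (star v) + ε • 1) * M)).re)
      (nhdsWithin 0 (Set.Ioi 0)) (nhds (star v ⬝ᵥ M *ᵥ v).re) := by
    simp only [add_mul, trace_add, Complex.add_re, hv, smul_mul_assoc, one_mul, trace_smul,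
      Complex.real_smul, Complex.re_ofReal_mul]
    exact tendsto_nhdsWithin_of_tendsto_nhds (Continuous.tendsto' (by fun_prop) _ _ (by simp))
  refine ge_of_tendsto hlim ?_
  filter_upwards [self_mem_nhdsWithin] with ε hε
  exact h _ (PosDef.posSemidef_add (posSemidef_vecMulVec_self_star v)
    (PosDef.one.smul (Set.mem_Ioi.mp hε)))

/-- If `f` is subentropic of order two then `f'` is operator monotone. -/
theorem subentropic_order_two_deriv_operator_monotone (f : ℝ → ℝ)
    (hf : SubentropicOfOrder f 2) :
    ∀ n : ℕ, ∀ ρ σ : Matrix (Fin n) (Fin n) ℂ, ρ.PosDef → σ.PosDef →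
      (σ - ρ).PosSemidef → (matFn (deriv f) σ - matFn (deriv f) ρ).PosSemidef := by
  intro n ρ σ hρ hσ hρσ
  refine ((matFn_isHermitian _).sub (matFn_isHermitian _)).posSemidef_of_re_trace_mul_nonneg
    fun X hX => ?_
  rw [mul_sub, trace_sub, Complex.sub_re, sub_nonneg]
  exact hf.re_trace_mul_matFn_deriv_mono hρ hσ hX hρσ

end
end

section
/- If f : (0,∞) → ℝ is subentropic of order two, then its second derivative f'' is a convex function on (0,∞). -/
open scoped Matrix
open Matrix
open scoped ComplexOrder

noncomputable section

/-- The real symmetric matrix with rows `(p, r)` and `(r, s)`, seen as a complex matrix. -/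
def symTwo (p r s : ℝ) : Matrix (Fin 2) (Fin 2) ℂ :=
  !![(p : ℂ), (r : ℂ); (r : ℂ), (s : ℂ)]

lemma symTwo_isHermitian (p r s : ℝ) : (symTwo p r s).IsHermitian := by
  ext i j
  fin_cases i <;> fin_cases j <;> simp [symTwo]

lemma symTwo_add (p r s p' r' s' : ℝ) :
    symTwo p r s + symTwo p' r' s' = symTwo (p + p') (r + r') (s + s') := by
  ext i j
  fin_cases i <;> fin_cases j <;> simp [symTwo]

lemma symTwo_smul (c p r s : ℝ) : c • symTwo p r s = symTwo (c * p) (c * r) (c * s) := by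
  ext i j
  fin_cases i <;> fin_cases j <;> simp [symTwo]

lemma symTwo_eigenvalues_add (p r s : ℝ) :
    (symTwo_isHermitian p r s).eigenvalues 0 + (symTwo_isHermitian p r s).eigenvalues 1 =
      p + s := by
  have h := (symTwo_isHermitian p r s).trace_eq_sum_eigenvalues
  rw [Fin.sum_univ_two] at h
  simp only [symTwo, Matrix.trace_fin_two_of] at h
  exact Complex.ofReal_injective (by push_cast; exact h.symm)

lemma symTwo_eigenvalues_mul (p r s : ℝ) :
    (symTwo_isHermitian p r s).eigenvalues 0 * (symTwo_isHermitian p r s).eigenvalues 1 =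
      p * s - r * r := by
  have h := (symTwo_isHermitian p r s).det_eq_prod_eigenvalues
  rw [Fin.prod_univ_two] at h
  simp only [symTwo, Matrix.det_fin_two_of] at h
  exact Complex.ofReal_injective (by push_cast; exact h.symm)

lemma symTwo_posDef {p r s : ℝ} (htr : 0 < p + s) (hdet : 0 < p * s - r * r) :
    (symTwo p r s).PosDef := by
  rw [(symTwo_isHermitian p r s).posDef_iff_eigenvalues_pos]
  rw [← symTwo_eigenvalues_add p r s] at htr
  rw [← symTwo_eigenvalues_mul p r s] at hdet
  rcases pos_and_pos_or_neg_and_neg_of_mul_pos hdet with h | h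
  · intro i
    fin_cases i
    exacts [h.1, h.2]
  · linarith [h.1, h.2]

lemma trFn_symTwo (f : ℝ → ℝ) {p r s l u : ℝ} (htr : p + s = l + u)
    (hdet : p * s - r * r = l * u) : trFn f (symTwo p r s) = f l + f u := by
  rw [trFn, dif_pos (symTwo_isHermitian p r s), Fin.sum_univ_two]
  rw [← symTwo_eigenvalues_add p r s] at htr
  rw [← symTwo_eigenvalues_mul p r s] at hdet
  generalize (symTwo_isHermitian p r s).eigenvalues 0 = x at *
  generalize (symTwo_isHermitian p r s).eigenvalues 1 = y at *
  have h : (x - l) * (x - u) = 0 := by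
    linear_combination x * htr - hdet
  rcases mul_eq_zero.1 h with h | h
  · rw [show x = l by linarith, show y = u by linarith]
  · rw [show x = u by linarith, show y = l by linarith, add_comm]

/-- The second symmetric difference `f (x + h) + f (x - h) - 2 f x`. -/
def symDiff₂ (h : ℝ) (f : ℝ → ℝ) (x : ℝ) : ℝ := f (x + h) + f (x - h) - 2 * f x

lemma SubentropicOfOrder.symDiff₂_shift_le {f : ℝ → ℝ} (hf : SubentropicOfOrder f 2)
    {m t e : ℝ} (ht : 0 < t) (hm : 4 * t < m) (he : 0 < e) :
    symDiff₂ (3 * t) f (m + e) ≤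
      f (m + 4 * t) + f (m - t) + (f (m - 4 * t) + f (m + t))
        - 2 * (f (m + 2 * t) + f (m - 2 * t)) := by
  set A : ℝ := (4 * t ^ 2 + 1) / e with hA
  have hAe : A * e = 4 * t ^ 2 + 1 := div_mul_cancel₀ _ he.ne'
  have hA0 : 0 < A := by positivity
  have hσ : (symTwo A (-(2 * t)) e).PosDef := symTwo_posDef (by linarith) (by nlinarith)
  have hp : ∀ i, ((![symTwo m (2 * t) (m + 3 * t), symTwo A (-(2 * t)) e] :
      Fin 2 → Matrix (Fin 2) (Fin 2) ℂ) i).PosDef := by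
    intro i
    fin_cases i
    · exact symTwo_posDef (by linarith) (by nlinarith)
    · exact hσ
  have hn : ∀ i, ((![symTwo m (2 * t) (m - 3 * t), symTwo A (-(2 * t)) e] :
      Fin 2 → Matrix (Fin 2) (Fin 2) ℂ) i).PosDef := by
    intro i
    fin_cases i
    · exact symTwo_posDef (by linarith) (by nlinarith)
    · exact hσ
  have key := (hf.2 2).2 hp hn (by norm_num : (0 : ℝ) ≤ 1 / 2)
    (by norm_num : (0 : ℝ) ≤ 1 / 2) (by norm_num)
  have hsum : ∀ τ : ℝ, trFn f (symTwo (m + A) (2 * t + -(2 * t)) (m + τ + e)) =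
      f (m + A) + f (m + e + τ) := fun τ => trFn_symTwo f (by ring) (by ring)
  have h0 := hsum 0
  have h1 := hsum (3 * t)
  have h2 := hsum (-(3 * t))
  simp only [Fin.sum_univ_two, Pi.add_apply, Pi.smul_apply, Matrix.cons_val_zero,
    Matrix.cons_val_one, symTwo_add, symTwo_smul, smul_eq_mul] at key
  rw [show (1 / 2 * m + 1 / 2 * m : ℝ) = m by ring,
    show (1 / 2 * (2 * t) + 1 / 2 * (2 * t) : ℝ) = 2 * t by ring,
    show (1 / 2 * (m + 3 * t) + 1 / 2 * (m - 3 * t) : ℝ) = m + 0 by ring,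
    show (1 / 2 * A + 1 / 2 * A : ℝ) = A by ring,
    show (1 / 2 * e + 1 / 2 * e : ℝ) = e by ring,
    show (1 / 2 * -(2 * t) + 1 / 2 * -(2 * t) : ℝ) = -(2 * t) by ring,
    show m - 3 * t = m + -(3 * t) by ring, h0, h1, h2,
    trFn_symTwo f (l := m + 2 * t) (u := m - 2 * t) (by ring) (by ring),
    trFn_symTwo f (p := m) (s := m + 3 * t) (l := m + 4 * t) (u := m - t) (by ring) (by ring),
    trFn_symTwo f (p := m) (s := m + -(3 * t)) (l := m - 4 * t) (u := m + t) (by ring) (by ring),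
    add_zero] at key
  rw [symDiff₂, sub_eq_add_neg (m + e)]
  linarith

lemma continuousAt_of_convexOn_Ioi {f : ℝ → ℝ} (hf : ConvexOn ℝ (Set.Ioi 0) f) {x : ℝ}
    (hx : 0 < x) : ContinuousAt f x :=
  (hf.continuousOn isOpen_Ioi).continuousAt (Ioi_mem_nhds hx)

lemma SubentropicOfOrder.symDiff₂_le {f : ℝ → ℝ} (hf : SubentropicOfOrder f 2)
    {m t : ℝ} (ht : 0 < t) (hm : 4 * t < m) :
    symDiff₂ (3 * t) f m ≤
      f (m + 4 * t) + f (m - t) + (f (m - 4 * t) + f (m + t))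
        - 2 * (f (m + 2 * t) + f (m - 2 * t)) := by
  have hc : ContinuousAt (fun e => symDiff₂ (3 * t) f (m + e)) 0 := by
    have h : ∀ c : ℝ, 0 < m + c → ContinuousAt (fun e : ℝ => f (m + e + c)) 0 := fun c hc =>
      ContinuousAt.comp' (f := fun e : ℝ => m + e + c) (g := f)
        (continuousAt_of_convexOn_Ioi hf.1 (by simpa using hc)) (by fun_prop)
    have h0 := h 0 (by linarith)
    have h1 := h (3 * t) (by linarith)
    have h2 := h (-(3 * t)) (by linarith)
    simp only [add_zero, ← sub_eq_add_neg] at h0 h2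
    exact (h1.add h2).sub (h0.const_mul 2)
  have hlim := hc.tendsto.mono_left (nhdsWithin_le_nhds (s := Set.Ioi 0))
  rw [add_zero] at hlim
  refine le_of_tendsto hlim ?_
  filter_upwards [self_mem_nhdsWithin] with e he
  exact hf.symDiff₂_shift_le ht hm he

/-- A positive average of the translates of `f` by multiples of `t`. -/
def latticeAvg (t : ℝ) (f : ℝ → ℝ) (x : ℝ) : ℝ :=
  (f (x - 2 * t) + 3 * f (x - t) + 4 * f x + 3 * f (x + t) + f (x + 2 * t)) / 12

lemma SubentropicOfOrder.symDiff₂_symDiff₂_latticeAvg_nonneg {f : ℝ → ℝ}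
    (hf : SubentropicOfOrder f 2) {x t : ℝ} (ht : 0 < t) (hx : 4 * t < x) :
    0 ≤ symDiff₂ t (symDiff₂ t (latticeAvg t f)) x := by
  have h := hf.symDiff₂_le ht hx
  simp only [symDiff₂, latticeAvg] at h ⊢
  ring_nf at h ⊢
  linarith

lemma symDiff₂_comm (s t : ℝ) (f : ℝ → ℝ) (x : ℝ) :
    symDiff₂ s (symDiff₂ t f) x = symDiff₂ t (symDiff₂ s f) x := by
  simp only [symDiff₂]
  ring_nf

lemma symDiff₂_two_mul (t : ℝ) (f : ℝ → ℝ) (x : ℝ) :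
    symDiff₂ (2 * t) f x = symDiff₂ t f (x + t) + 2 * symDiff₂ t f x + symDiff₂ t f (x - t) := by
  simp only [symDiff₂]
  ring_nf

lemma symDiff₂_symDiff₂_pow_mul_nonneg {g : ℝ → ℝ} {c t : ℝ} (ht : 0 < t)
    (hg : ∀ x, c + 2 * t < x → 0 ≤ symDiff₂ t (symDiff₂ t g) x) (i j : ℕ) :
    ∀ x, c + 2 ^ i * t + 2 ^ j * t < x →
      0 ≤ symDiff₂ (2 ^ i * t) (symDiff₂ (2 ^ j * t) g) x := by
  induction i with
  | zero =>
    induction j with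
    | zero => exact fun x hx => by simpa using hg x (by linarith)
    | succ j ih =>
      intro x hx
      rw [pow_succ', mul_assoc] at hx ⊢
      have h0 : 0 < 2 ^ j * t := by positivity
      rw [symDiff₂_comm, symDiff₂_two_mul]
      simp only [symDiff₂_comm (2 ^ j * t)]
      linarith [ih (x + 2 ^ j * t) (by linarith), ih x (by linarith),
        ih (x - 2 ^ j * t) (by linarith)]
  | succ i ih =>
    intro x hx
    rw [pow_succ', mul_assoc] at hx ⊢
    have h0 : 0 < 2 ^ i * t := by positivity
    rw [symDiff₂_two_mul]
    linarith [ih (x + 2 ^ i * t) (by linarith), ih x (by linarith),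
      ih (x - 2 ^ i * t) (by linarith)]

open Filter Topology in
lemma tendsto_half_pow_zero : Tendsto (fun n : ℕ => (1 / 2 : ℝ) ^ n) atTop (𝓝 0) :=
  tendsto_pow_atTop_nhds_zero_of_lt_one (by norm_num) (by norm_num)

open Filter Topology in
lemma tendsto_latticeAvg {f : ℝ → ℝ} {x : ℝ} (hf : ContinuousAt f x) :
    Tendsto (fun n : ℕ => latticeAvg ((1 / 2) ^ n) f x) atTop (𝓝 (f x)) := by
  have h : ∀ c : ℝ, Tendsto (fun n : ℕ => f (x + c * (1 / 2) ^ n)) atTop (𝓝 (f x)) := fun c =>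
    hf.tendsto.comp (by simpa using (tendsto_half_pow_zero.const_mul c).const_add x)
  have := (((((h (-2)).add ((h (-1)).const_mul 3)).add ((h 0).const_mul 4)).add
    ((h 1).const_mul 3)).add (h 2)).div_const 12
  convert this using 2
  · simp only [latticeAvg]
    ring_nf
  · ring

open Filter Topology in
lemma SubentropicOfOrder.symDiff₂_symDiff₂_nonneg {f : ℝ → ℝ} (hf : SubentropicOfOrder f 2)
    (i j : ℕ) {x : ℝ} (hx : (1 / 2) ^ i + (1 / 2) ^ j < x) :
    0 ≤ symDiff₂ ((1 / 2) ^ i) (symDiff₂ ((1 / 2) ^ j) f) x := by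
  have hi : (0 : ℝ) < (1 / 2) ^ i := by positivity
  have hj : (0 : ℝ) < (1 / 2) ^ j := by positivity
  have hlim : Tendsto (fun n : ℕ => symDiff₂ ((1 / 2) ^ i) (symDiff₂ ((1 / 2) ^ j)
      (latticeAvg ((1 / 2) ^ n) f)) x) atTop
      (𝓝 (symDiff₂ ((1 / 2) ^ i) (symDiff₂ ((1 / 2) ^ j) f) x)) := by
    have h : ∀ y, 0 < y → Tendsto (fun n : ℕ => latticeAvg ((1 / 2) ^ n) f y) atTop (𝓝 (f y)) :=
      fun y hy => tendsto_latticeAvg (continuousAt_of_convexOn_Ioi hf.1 hy)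
    have h' : ∀ y, (1 / 2) ^ j < y → Tendsto (fun n : ℕ => symDiff₂ ((1 / 2) ^ j)
        (latticeAvg ((1 / 2) ^ n) f) y) atTop (𝓝 (symDiff₂ ((1 / 2) ^ j) f y)) := fun y hy =>
      ((h _ (by linarith)).add (h _ (by linarith))).sub ((h y (by linarith)).const_mul 2)
    exact ((h' _ (by linarith)).add (h' _ (by linarith))).sub ((h' x (by linarith)).const_mul 2)
  refine ge_of_tendsto hlim ?_
  have hev : ∀ᶠ n : ℕ in atTop, 2 * (1 / 2 : ℝ) ^ n < x - (1 / 2) ^ i - (1 / 2) ^ j :=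
    (tendsto_half_pow_zero.const_mul 2).eventually_lt_const (by linarith)
  filter_upwards [hev, eventually_ge_atTop i, eventually_ge_atTop j] with n hn hin hjn
  have hpow : ∀ k ≤ n, (2 : ℝ) ^ (n - k) * (1 / 2) ^ n = (1 / 2) ^ k := fun k hk => by
    obtain ⟨d, rfl⟩ := Nat.exists_eq_add_of_le hk
    rw [Nat.add_sub_cancel_left, pow_add, mul_left_comm, ← mul_pow]
    norm_num
  have h0 : (0 : ℝ) < (1 / 2) ^ n := by positivity
  have := symDiff₂_symDiff₂_pow_mul_nonneg (g := latticeAvg ((1 / 2) ^ n) f)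
    (c := 2 * (1 / 2) ^ n) h0
    (fun y hy => hf.symDiff₂_symDiff₂_latticeAvg_nonneg h0 (by linarith)) (n - i) (n - j) x
  rw [hpow i hin, hpow j hjn] at this
  exact this (by linarith)

open Filter Topology in
/-- A continuous function whose dyadic second symmetric differences are asymptotically
nonnegative lies below its chord. -/
lemma le_chord_of_symDiff₂ {w : ℝ → ℝ} {a b : ℝ} (hab : a < b)
    (hw : ContinuousOn w (Set.Icc a b))
    (h : ∀ x ∈ Set.Ioo a b, ∀ ε > 0, ∃ᶠ n : ℕ in atTop,
      -ε * ((1 / 2) ^ n) ^ 2 ≤ symDiff₂ ((1 / 2) ^ n) w x) {x : ℝ} (hx : x ∈ Set.Icc a b) :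
    w x ≤ w a + (w b - w a) / (b - a) * (x - a) := by
  set k := (w b - w a) / (b - a) with hk
  have hkb : k * (b - a) = w b - w a := div_mul_cancel₀ _ (by linarith)
  have main : ∀ ε > 0, w x - (w a + k * (x - a)) + ε * ((x - a) * (x - b)) ≤ 0 := by
    intro ε hε
    set v : ℝ → ℝ := fun y => w y - (w a + k * (y - a)) + ε * ((y - a) * (y - b)) with hv
    have hvc : ContinuousOn v (Set.Icc a b) := by
      refine (hw.sub ?_).add ?_ <;> fun_prop
    obtain ⟨c, hc, hmax⟩ := isCompact_Icc.exists_isMaxOn ⟨x, hx⟩ hvc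
    refine (hmax hx).trans ?_
    by_contra hpos
    have hpos : 0 < v c := not_le.1 hpos
    have hva : v a = 0 := by simp [hv]
    have hvb : v b = 0 := by simp only [hv]; linarith
    have hac : a < c := lt_of_le_of_ne hc.1 (by rintro rfl; linarith)
    have hcb : c < b := lt_of_le_of_ne hc.2 (by rintro rfl; linarith)
    have hev : ∀ᶠ n : ℕ in atTop, (1 / 2 : ℝ) ^ n < min (c - a) (b - c) :=
      tendsto_half_pow_zero.eventually_lt_const (lt_min (by linarith) (by linarith))
    obtain ⟨n, hn1, hn2⟩ := ((h c ⟨hac, hcb⟩ ε hε).and_eventually hev).exists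
    obtain ⟨hn3, hn4⟩ := lt_min_iff.1 hn2
    have h0 : (0 : ℝ) < (1 / 2) ^ n := by positivity
    generalize (1 / 2 : ℝ) ^ n = t at *
    have h1 : v (c + t) ≤ v c := hmax ⟨by linarith, by linarith⟩
    have h2 : v (c - t) ≤ v c := hmax ⟨by linarith, by linarith⟩
    simp only [hv] at h1 h2
    simp only [symDiff₂] at hn1
    nlinarith [mul_pos hε (pow_pos h0 2)]
  have hlim : Tendsto (fun ε : ℝ => w x - (w a + k * (x - a)) + ε * ((x - a) * (x - b)))
      (𝓝[>] 0) (𝓝 (w x - (w a + k * (x - a)))) := by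
    have : ContinuousAt (fun ε : ℝ => w x - (w a + k * (x - a)) + ε * ((x - a) * (x - b))) 0 := by
      fun_prop
    simpa using this.tendsto.mono_left nhdsWithin_le_nhds
  have := le_of_tendsto hlim (eventually_nhdsWithin_of_forall main)
  linarith

lemma convexOn_of_le_chord {s : Set ℝ} (hs : Convex ℝ s) {w : ℝ → ℝ}
    (h : ∀ a ∈ s, ∀ b ∈ s, a < b → ∀ x ∈ Set.Icc a b,
      w x ≤ w a + (w b - w a) / (b - a) * (x - a)) : ConvexOn ℝ s w := by
  refine LinearOrder.convexOn_of_lt hs fun a ha b hb hab p q hp hq hpq => ?_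
  obtain rfl : p = 1 - q := by linarith
  have hba : b - a ≠ 0 := by linarith
  refine (h a ha b hb hab _ ⟨?_, ?_⟩).trans_eq ?_
  · simp only [smul_eq_mul]; nlinarith
  · simp only [smul_eq_mul]; nlinarith
  · simp only [smul_eq_mul]; field_simp; ring

open Filter Topology in
lemma SubentropicOfOrder.convexOn_symDiff₂ {f : ℝ → ℝ} (hf : SubentropicOfOrder f 2) (j : ℕ) :
    ConvexOn ℝ (Set.Ioi ((1 / 2) ^ j)) (symDiff₂ ((1 / 2) ^ j) f) := by
  have hj : (0 : ℝ) < (1 / 2) ^ j := by positivity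
  refine convexOn_of_le_chord (convex_Ioi _) fun a ha b _ hab x hx => ?_
  rw [Set.mem_Ioi] at ha
  refine le_chord_of_symDiff₂ hab (fun y hy => ContinuousAt.continuousWithinAt ?_)
    (fun y hy ε hε => Eventually.frequently ?_) hx
  · have hc : ∀ c : ℝ, 0 < y + c → ContinuousAt (fun z : ℝ => f (z + c)) y := fun c hc =>
      ContinuousAt.comp' (f := fun z : ℝ => z + c) (g := f)
        (continuousAt_of_convexOn_Ioi hf.1 hc) (by fun_prop)
    have h0 := hc 0 (by linarith [hy.1])
    have h1 := hc ((1 / 2) ^ j) (by linarith [hy.1])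
    have h2 := hc (-(1 / 2) ^ j) (by linarith [hy.1])
    simp only [add_zero, ← sub_eq_add_neg] at h0 h2
    exact (h1.add h2).sub (h0.const_mul 2)
  · have hev : ∀ᶠ n : ℕ in atTop, (1 / 2 : ℝ) ^ n < y - (1 / 2) ^ j :=
      tendsto_half_pow_zero.eventually_lt_const (by linarith [hy.1])
    filter_upwards [hev] with n hn
    have := hf.symDiff₂_symDiff₂_nonneg n j (x := y) (by linarith)
    have h0 : 0 ≤ ε * ((1 / 2 : ℝ) ^ n) ^ 2 := by positivity
    linarith

lemma ConvexOn.symDiff₂_nonneg {f : ℝ → ℝ} (hf : ConvexOn ℝ (Set.Ioi 0) f) {x h : ℝ}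
    (hh : 0 < h) (hx : h < x) : 0 ≤ symDiff₂ h f x := by
  have hp : x + h ∈ Set.Ioi (0 : ℝ) := by rw [Set.mem_Ioi]; linarith
  have hn : x - h ∈ Set.Ioi (0 : ℝ) := by simpa using hx
  have := hf.2 hp hn (by norm_num : (0 : ℝ) ≤ 1 / 2) (by norm_num : (0 : ℝ) ≤ 1 / 2) (by norm_num)
  simp only [smul_eq_mul] at this
  rw [show 1 / 2 * (x + h) + 1 / 2 * (x - h) = x by ring] at this
  rw [symDiff₂]
  linarith

open Filter Topology in
lemma SubentropicOfOrder.exists_tendsto_symDiff₂ {f : ℝ → ℝ} (hf : SubentropicOfOrder f 2)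
    {x : ℝ} (hx : 0 < x) :
    ∃ l, Tendsto (fun n : ℕ => symDiff₂ ((1 / 2) ^ n) f x / ((1 / 2) ^ n) ^ 2) atTop (𝓝 l) := by
  obtain ⟨N, hN⟩ := (tendsto_half_pow_zero.eventually_lt_const hx).exists
  have hlt : ∀ n, (1 / 2 : ℝ) ^ (n + N) < x := fun n =>
    (pow_le_pow_of_le_one (by norm_num) (by norm_num) (Nat.le_add_left N n)).trans_lt hN
  have hanti : Antitone
      (fun n : ℕ => symDiff₂ ((1 / 2) ^ (n + N)) f x / ((1 / 2) ^ (n + N)) ^ 2) := by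
    refine antitone_nat_of_succ_le fun n => ?_
    have hd : (1 / 2 : ℝ) ^ (n + N) = 2 * (1 / 2) ^ (n + 1 + N) := by ring
    have h4 := hf.symDiff₂_symDiff₂_nonneg (n + 1 + N) (n + 1 + N) (x := x)
      (by linarith [hlt n])
    have h0 : (0 : ℝ) < (1 / 2) ^ (n + 1 + N) := by positivity
    rw [hd, symDiff₂_two_mul]
    generalize (1 / 2 : ℝ) ^ (n + 1 + N) = t at *
    rw [symDiff₂] at h4
    rw [div_le_div_iff₀ (by positivity) (by positivity)]
    nlinarith [pow_pos h0 2]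
  have hbdd : BddBelow (Set.range
      (fun n : ℕ => symDiff₂ ((1 / 2) ^ (n + N)) f x / ((1 / 2) ^ (n + N)) ^ 2)) := by
    refine ⟨0, ?_⟩
    rintro _ ⟨n, rfl⟩
    exact div_nonneg (hf.1.symDiff₂_nonneg (by positivity) (hlt n)) (by positivity)
  exact ⟨_, (tendsto_add_atTop_iff_nat N).1 (tendsto_atTop_ciInf hanti hbdd)⟩

open Filter Topology in
lemma SubentropicOfOrder.convexOn_of_tendsto_symDiff₂ {f q : ℝ → ℝ}
    (hf : SubentropicOfOrder f 2) (hq : ∀ x, 0 < x → Tendsto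
      (fun n : ℕ => symDiff₂ ((1 / 2) ^ n) f x / ((1 / 2) ^ n) ^ 2) atTop (𝓝 (q x))) :
    ConvexOn ℝ (Set.Ioi 0) q := by
  refine ⟨convex_Ioi 0, fun x hx y hy a b ha hb hab => ?_⟩
  have hxy := convex_Ioi (0 : ℝ) hx hy ha hb hab
  refine le_of_tendsto_of_tendsto (hq _ hxy)
    (((hq x hx).const_mul a).add ((hq y hy).const_mul b)) ?_
  filter_upwards [tendsto_half_pow_zero.eventually_lt_const hx,
    tendsto_half_pow_zero.eventually_lt_const hy] with n hnx hny
  have := (hf.convexOn_symDiff₂ n).2 hnx hny ha hb hab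
  rw [← mul_div_assoc, ← mul_div_assoc, ← add_div]
  gcongr
  exact this

open Filter Topology in
lemma tendsto_symDiff₂_of_hasDerivAt {Q Q₁ : ℝ → ℝ} {x l : ℝ}
    (hQ : ∀ᶠ y in 𝓝 x, HasDerivAt Q (Q₁ y) y) (hQ₁ : HasDerivAt Q₁ l x) :
    Tendsto (fun t => symDiff₂ t Q x / t ^ 2) (𝓝[>] 0) (𝓝 l) := by
  have hadd : Tendsto (fun t : ℝ => x + t) (𝓝[>] 0) (𝓝 x) := by
    have : ContinuousAt (fun t : ℝ => x + t) 0 := by fun_prop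
    simpa using this.tendsto.mono_left nhdsWithin_le_nhds
  have hsub : Tendsto (fun t : ℝ => x - t) (𝓝[>] 0) (𝓝 x) := by
    have : ContinuousAt (fun t : ℝ => x - t) 0 := by fun_prop
    simpa using this.tendsto.mono_left nhdsWithin_le_nhds
  have hQc := hQ.self_of_nhds.continuousAt.tendsto
  refine HasDerivAt.lhopital_zero_nhdsGT (f' := fun t => Q₁ (x + t) - Q₁ (x - t))
    (g' := fun t => 2 * t) ?_ ?_ ?_ ?_ ?_ ?_
  · filter_upwards [hadd.eventually hQ, hsub.eventually hQ] with t h1 h2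
    have h1' := h1.comp_const_add x t
    have h2' := h2.comp_const_sub x t
    simpa [symDiff₂, sub_eq_add_neg] using (h1'.add h2').sub_const (2 * Q x)
  · exact Eventually.of_forall fun t => by simpa using hasDerivAt_pow 2 t
  · filter_upwards [self_mem_nhdsWithin] with t ht
    exact mul_ne_zero two_ne_zero (ne_of_gt ht)
  · have := ((hQc.comp hadd).add (hQc.comp hsub)).sub_const (2 * Q x)
    rw [show Q x + Q x - 2 * Q x = 0 by ring] at this
    exact this
  · have : ContinuousAt (fun t : ℝ => t ^ 2) 0 := by fun_prop
    simpa using this.tendsto.mono_left nhdsWithin_le_nhds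
  · have h1 : HasDerivAt (fun t => Q₁ (x + t)) l 0 := by
      have := HasDerivAt.comp_const_add x 0 (by simpa using hQ₁)
      exact this
    have h2 : HasDerivAt (fun t => Q₁ (x - t)) (-l) 0 := by
      have := HasDerivAt.comp_const_sub x 0 (by simpa using hQ₁)
      exact this
    have h3 := ((h1.sub h2).tendsto_slope_zero_right).div_const 2
    rw [show (l - -l) / 2 = l by ring] at h3
    refine h3.congr' ?_
    filter_upwards [self_mem_nhdsWithin] with t ht
    have ht : t ≠ 0 := ne_of_gt ht
    simp only [zero_add, Pi.sub_apply, add_zero, sub_zero, sub_self, smul_eq_mul]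
    field_simp

lemma hasDerivAt_integral_of_continuousOn_Ioi {q : ℝ → ℝ} (hq : ContinuousOn q (Set.Ioi 0))
    {x : ℝ} (hx : 0 < x) : HasDerivAt (fun y => ∫ t in (1 : ℝ)..y, q t) (q x) x := by
  refine intervalIntegral.integral_hasDerivAt_right ?_ ?_
    (hq.continuousAt (Ioi_mem_nhds hx))
  · refine (hq.mono fun y hy => ?_).intervalIntegrable
    exact (lt_min one_pos hx).trans_le hy.1
  · exact hq.stronglyMeasurableAtFilter isOpen_Ioi x hx

open Filter Topology in
/-- A continuous function on `(0,∞)` whose dyadic second symmetric derivative is a continuous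
function `q` is twice differentiable with second derivative `q`. -/
lemma deriv_deriv_eq_of_tendsto_symDiff₂ {f q : ℝ → ℝ} (hf : ContinuousOn f (Set.Ioi 0))
    (hqc : ContinuousOn q (Set.Ioi 0)) (hq : ∀ x, 0 < x → Tendsto
      (fun n : ℕ => symDiff₂ ((1 / 2) ^ n) f x / ((1 / 2) ^ n) ^ 2) atTop (𝓝 (q x)))
    {x : ℝ} (hx : 0 < x) : deriv (deriv f) x = q x := by
  set Q₁ : ℝ → ℝ := fun y => ∫ t in (1 : ℝ)..y, q t
  have hQ₁ : ∀ y, 0 < y → HasDerivAt Q₁ (q y) y := fun y hy =>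
    hasDerivAt_integral_of_continuousOn_Ioi hqc hy
  set Q : ℝ → ℝ := fun y => ∫ t in (1 : ℝ)..y, Q₁ t
  have hQ : ∀ y, 0 < y → HasDerivAt Q (Q₁ y) y := fun y hy =>
    hasDerivAt_integral_of_continuousOn_Ioi
      (fun z hz => (hQ₁ z hz).continuousAt.continuousWithinAt) hy
  have hQc : ContinuousOn Q (Set.Ioi 0) := fun z hz => (hQ z hz).continuousAt.continuousWithinAt
  have hhalf : Tendsto (fun n : ℕ => (1 / 2 : ℝ) ^ n) atTop (𝓝[>] 0) :=
    tendsto_nhdsWithin_iff.2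
      ⟨tendsto_half_pow_zero, Eventually.of_forall fun n => Set.mem_Ioi.2 (by positivity)⟩
  have hQlim : ∀ y, 0 < y → Tendsto
      (fun n : ℕ => symDiff₂ ((1 / 2) ^ n) Q y / ((1 / 2) ^ n) ^ 2) atTop (𝓝 (q y)) := fun y hy =>
    (tendsto_symDiff₂_of_hasDerivAt (Filter.mem_of_superset (Ioi_mem_nhds hy) hQ) (hQ₁ y hy)).comp hhalf
  have hlow : ∀ u v : ℝ → ℝ, (∀ y, 0 < y → Tendsto
      (fun n : ℕ => symDiff₂ ((1 / 2) ^ n) u y / ((1 / 2) ^ n) ^ 2) atTop (𝓝 (q y))) →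
      (∀ y, 0 < y → Tendsto
      (fun n : ℕ => symDiff₂ ((1 / 2) ^ n) v y / ((1 / 2) ^ n) ^ 2) atTop (𝓝 (q y))) →
      ∀ y, 0 < y → ∀ ε > 0, ∃ᶠ n : ℕ in atTop,
        -ε * ((1 / 2) ^ n) ^ 2 ≤ symDiff₂ ((1 / 2) ^ n) (u - v) y := by
    intro u v hu hv y hy ε hε
    have h := (hu y hy).sub (hv y hy)
    rw [sub_self] at h
    refine Eventually.frequently ?_
    filter_upwards [h.eventually_const_lt (neg_lt_zero.2 hε)] with n hn
    rw [← sub_div, lt_div_iff₀ (by positivity)] at hn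
    simp only [symDiff₂, Pi.sub_apply] at hn ⊢
    linarith
  have ha : 0 < x / 2 := by linarith
  have hab : x / 2 < 2 * x := by linarith
  have hsub : Set.Icc (x / 2) (2 * x) ⊆ Set.Ioi 0 := fun y hy => ha.trans_le hy.1
  obtain ⟨k, c, hkc⟩ : ∃ k c : ℝ, ∀ y ∈ Set.Icc (x / 2) (2 * x), f y = Q y + (k * y + c) := by
    set k := ((f - Q) (2 * x) - (f - Q) (x / 2)) / (2 * x - x / 2) with hk
    refine ⟨k, (f - Q) (x / 2) - k * (x / 2), fun y hy => ?_⟩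
    have h1 := le_chord_of_symDiff₂ hab ((hf.sub hQc).mono hsub)
      (fun z hz => hlow f Q hq hQlim z (ha.trans hz.1)) hy
    have h2 := le_chord_of_symDiff₂ hab ((hQc.sub hf).mono hsub)
      (fun z hz => hlow Q f hQlim hq z (ha.trans hz.1)) hy
    have hk' : ((Q - f) (2 * x) - (Q - f) (x / 2)) / (2 * x - x / 2) = -k := by
      rw [hk, ← neg_div]
      simp only [Pi.sub_apply]
      ring
    rw [← hk] at h1
    rw [hk'] at h2
    simp only [Pi.sub_apply] at h1 h2 ⊢
    linarith
  have hf1 : ∀ y ∈ Set.Ioo (x / 2) (2 * x), deriv f y = Q₁ y + k := by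
    intro y hy
    have hlin : HasDerivAt (fun y => Q y + (k * y + c)) (Q₁ y + k) y := by
      have := (hQ y (ha.trans hy.1)).add (((hasDerivAt_id y).const_mul k).add_const c)
      rw [mul_one] at this
      exact this
    refine (hlin.congr_of_eventuallyEq ?_).deriv
    filter_upwards [Icc_mem_nhds hy.1 hy.2] with z hz using hkc z hz
  refine (((hQ₁ x hx).add_const k).congr_of_eventuallyEq ?_).deriv
  filter_upwards [Ioo_mem_nhds (show x / 2 < x by linarith) (show x < 2 * x by linarith)]
    with z hz using hf1 z hz

/-- If `f` is subentropic of order two then `f''` is convex on `(0,∞)`. -/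
theorem subentropic_order_two_second_deriv_convex (f : ℝ → ℝ)
    (hf : SubentropicOfOrder f 2) :
    ConvexOn ℝ (Set.Ioi (0 : ℝ)) (deriv (deriv f)) := by
  choose! q hq using fun (x : ℝ) (hx : 0 < x) => hf.exists_tendsto_symDiff₂ hx
  have hconv := hf.convexOn_of_tendsto_symDiff₂ hq
  refine hconv.congr fun x hx => Eq.symm ?_
  exact deriv_deriv_eq_of_tendsto_symDiff₂ (hf.1.continuousOn isOpen_Ioi)
    (hconv.continuousOn isOpen_Ioi) hq hx

end
end

section
/- A twice continuously differentiable function f : (0,∞) → ℝ with strictly positive second derivative is subentropic if and only if the inequality (df'(ρ+σ))⁻¹ ≥ (df'(ρ))⁻¹ + (df'(σ))⁻¹ holds (as positive definite operators on B(H)) for all positive definite operators ρ and σ on any finite-dimensional Hilbert space H. -/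
open scoped Matrix
open Matrix
open scoped ComplexOrder

noncomputable section

section Spectral

variable {d : Type} [Fintype d] [DecidableEq d]

lemma matFn_of_isHermitian (g : ℝ → ℝ) {A : Matrix d d ℂ} (hA : A.IsHermitian) :
    matFn g A = (hA.eigenvectorUnitary : Matrix d d ℂ) *
      diagonal (fun i => (g (hA.eigenvalues i) : ℂ)) *
      star (hA.eigenvectorUnitary : Matrix d d ℂ) := dif_pos hA

lemma trFn_of_isHermitian (g : ℝ → ℝ) {A : Matrix d d ℂ} (hA : A.IsHermitian) :
    trFn g A = ∑ i, g (hA.eigenvalues i) := dif_pos hA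

lemma matFn_one {A : Matrix d d ℂ} (hA : A.IsHermitian) : matFn (fun _ => 1) A = 1 := by
  simp [matFn_of_isHermitian _ hA]

lemma matFn_id {A : Matrix d d ℂ} (hA : A.IsHermitian) : matFn (fun x => x) A = A := by
  rw [matFn_of_isHermitian _ hA]
  conv_rhs => rw [hA.spectral_theorem]
  rw [Unitary.conjStarAlgAut_apply]
  rfl

lemma matFn_mul (p q : ℝ → ℝ) {A : Matrix d d ℂ} (hA : A.IsHermitian) :
    matFn p A * matFn q A = matFn (fun x => p x * q x) A := by
  have hU : star (hA.eigenvectorUnitary : Matrix d d ℂ) * (hA.eigenvectorUnitary : Matrix d d ℂ)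
      = 1 := Unitary.coe_star_mul_self _
  simp only [matFn_of_isHermitian _ hA, Complex.ofReal_mul, ← diagonal_mul_diagonal]
  simp only [Matrix.mul_assoc]
  rw [← Matrix.mul_assoc (star _) (hA.eigenvectorUnitary : Matrix d d ℂ), hU, Matrix.one_mul]

lemma matFn_pow (l : ℕ) {A : Matrix d d ℂ} (hA : A.IsHermitian) :
    matFn (fun x => x ^ l) A = A ^ l := by
  induction l with
  | zero => simpa using matFn_one hA
  | succ l ih =>
    have h := matFn_mul (fun x => x ^ l) (fun x => x) hA
    rw [ih, matFn_id hA] at h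
    simpa [pow_succ] using h.symm

lemma trace_matFn (g : ℝ → ℝ) {A : Matrix d d ℂ} (hA : A.IsHermitian) :
    (matFn g A).trace = (trFn g A : ℂ) := by
  have hU : star (hA.eigenvectorUnitary : Matrix d d ℂ) * (hA.eigenvectorUnitary : Matrix d d ℂ)
      = 1 := Unitary.coe_star_mul_self _
  rw [matFn_of_isHermitian _ hA, trFn_of_isHermitian _ hA, trace_mul_comm, ← Matrix.mul_assoc, hU]
  simp [trace]

/-- The matrix of `X` from an eigenbasis of `A` to an eigenbasis of `B`. -/
def eigMatrix {A B : Matrix d d ℂ} (hB : B.IsHermitian) (hA : A.IsHermitian) (X : Matrix d d ℂ) :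
    Matrix d d ℂ :=
  star (hB.eigenvectorUnitary : Matrix d d ℂ) * X * (hA.eigenvectorUnitary : Matrix d d ℂ)

lemma trace_conj_diagonal (U V X Y : Matrix d d ℂ) (p q : d → ℂ) :
    trace (V * diagonal p * star V * X * (U * diagonal q * star U) * star Y) =
      ∑ j, ∑ i, p j * q i * ((star V * X * U) j i * star ((star V * Y * U) j i)) := by
  have h : trace (V * diagonal p * star V * X * (U * diagonal q * star U) * star Y) =
      trace (diagonal p * (star V * X * U) * diagonal q * star (star V * Y * U)) := by
    simp only [star_mul, star_star, Matrix.mul_assoc]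
    rw [Matrix.trace_mul_comm V]
    simp only [Matrix.mul_assoc]
  rw [h]
  simp only [trace, diag, Matrix.mul_apply (M := diagonal p * (star V * X * U) * diagonal q),
    mul_diagonal, diagonal_mul, star_apply]
  refine Finset.sum_congr rfl fun j _ => Finset.sum_congr rfl fun i _ => ?_
  ring

lemma trace_matFn_mul_matFn (p q : ℝ → ℝ) {A B : Matrix d d ℂ} (hB : B.IsHermitian)
    (hA : A.IsHermitian) (X Y : Matrix d d ℂ) :
    trace (matFn p B * X * matFn q A * star Y) =
      ∑ j, ∑ i, (p (hB.eigenvalues j) : ℂ) * q (hA.eigenvalues i) *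
        (eigMatrix hB hA X j i * star (eigMatrix hB hA Y j i)) := by
  rw [matFn_of_isHermitian _ hA, matFn_of_isHermitian _ hB, trace_conj_diagonal]
  rfl

lemma eigMatrix_sub {A B : Matrix d d ℂ} (hB : B.IsHermitian) (hA : A.IsHermitian) (j i : d) :
    eigMatrix hB hA (B - A) j i =
      ((hB.eigenvalues j : ℂ) - hA.eigenvalues i) * eigMatrix hB hA 1 j i := by
  have hU : star (hA.eigenvectorUnitary : Matrix d d ℂ) * (hA.eigenvectorUnitary : Matrix d d ℂ)
      = 1 := Unitary.coe_star_mul_self _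
  have hV : star (hB.eigenvectorUnitary : Matrix d d ℂ) * (hB.eigenvectorUnitary : Matrix d d ℂ)
      = 1 := Unitary.coe_star_mul_self _
  have h1 : eigMatrix hB hA B =
      diagonal (fun i => (hB.eigenvalues i : ℂ)) * eigMatrix hB hA 1 := by
    have h := (matFn_of_isHermitian _ hB).symm.trans (matFn_id hB)
    rw [eigMatrix]
    nth_rewrite 2 [← h]
    rw [← Matrix.mul_assoc, ← Matrix.mul_assoc, hV, eigMatrix]
    simp [Matrix.mul_assoc]
  have h2 : eigMatrix hB hA A =
      eigMatrix hB hA 1 * diagonal (fun i => (hA.eigenvalues i : ℂ)) := by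
    have h := (matFn_of_isHermitian _ hA).symm.trans (matFn_id hA)
    rw [eigMatrix]
    nth_rewrite 1 [← h]
    rw [eigMatrix]
    simp only [Matrix.mul_assoc, hU]
    simp
  have h3 : eigMatrix hB hA (B - A) = eigMatrix hB hA B - eigMatrix hB hA A := by
    simp [eigMatrix, Matrix.mul_sub, Matrix.sub_mul]
  rw [h3, h1, h2, Matrix.sub_apply, diagonal_mul, mul_diagonal]
  ring

lemma eigMatrix_smul {A B : Matrix d d ℂ} (hB : B.IsHermitian) (hA : A.IsHermitian)
    (t : ℝ) (X : Matrix d d ℂ) (j i : d) :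
    eigMatrix hB hA (t • X) j i = t * eigMatrix hB hA X j i := by
  simp [eigMatrix]

/-- The weighted sum `∑ K(bⱼ, aᵢ) |⟨vⱼ, X uᵢ⟩|²` over eigenpairs `(bⱼ, vⱼ)` of `B` and
`(aᵢ, uᵢ)` of `A`. -/
def spectralForm (K : ℝ → ℝ → ℝ) {A B : Matrix d d ℂ} (hB : B.IsHermitian) (hA : A.IsHermitian)
    (X : Matrix d d ℂ) : ℝ :=
  ∑ j, ∑ i, K (hB.eigenvalues j) (hA.eigenvalues i) * Complex.normSq (eigMatrix hB hA X j i)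

lemma trace_matFn_mul_matFn_self (p q : ℝ → ℝ) {A B : Matrix d d ℂ} (hB : B.IsHermitian)
    (hA : A.IsHermitian) (X : Matrix d d ℂ) :
    trace (matFn p B * X * matFn q A * star X) =
      (spectralForm (fun b a => p b * q a) hB hA X : ℂ) := by
  rw [trace_matFn_mul_matFn, spectralForm]
  push_cast
  refine Finset.sum_congr rfl fun j _ => Finset.sum_congr rfl fun i _ => ?_
  rw [← Complex.mul_conj]
  rfl

lemma spectralForm_pow (l m : ℕ) {A B : Matrix d d ℂ} (hB : B.IsHermitian)
    (hA : A.IsHermitian) (X : Matrix d d ℂ) :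
    spectralForm (fun b a => b ^ l * a ^ m) hB hA X = (trace (B ^ l * X * A ^ m * star X)).re := by
  have h := trace_matFn_mul_matFn_self (fun x => x ^ l) (fun x => x ^ m) hB hA X
  rw [matFn_pow, matFn_pow] at h
  · rw [h, Complex.ofReal_re]
  all_goals assumption

lemma spectralForm_one (X : Matrix d d ℂ) {A B : Matrix d d ℂ} (hB : B.IsHermitian)
    (hA : A.IsHermitian) :
    spectralForm (fun _ _ => 1) hB hA X = (trace (X * star X)).re := by
  simpa using spectralForm_pow 0 0 hB hA X

/-- Klein's identity. -/
lemma trFn_sub_sub (f g : ℝ → ℝ) {A B : Matrix d d ℂ} (hB : B.IsHermitian)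
    (hA : A.IsHermitian) :
    trFn f B - trFn f A - (trace ((B - A) * matFn g A)).re =
      spectralForm (fun b a => f b - f a - g a * (b - a)) hB hA 1 := by
  have h (p q : ℝ → ℝ) := congrArg Complex.re (trace_matFn_mul_matFn_self p q hB hA 1)
  simp only [Matrix.mul_one, star_one, Complex.ofReal_re] at h
  have h1 := h f (fun _ => 1)
  have h2 := h (fun _ => 1) f
  have h3 := h (fun x => x) g
  have h4 := h (fun _ => 1) (fun x => x * g x)
  rw [matFn_one hA, Matrix.mul_one, trace_matFn f hB, Complex.ofReal_re] at h1
  rw [matFn_one hB, Matrix.one_mul, trace_matFn f hA, Complex.ofReal_re] at h2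
  rw [matFn_id hB] at h3
  rw [matFn_one hB, Matrix.one_mul, ← matFn_mul _ _ hA, matFn_id hA] at h4
  rw [Matrix.sub_mul, trace_sub, Complex.sub_re, h1, h2, h3, h4]
  simp only [spectralForm, ← Finset.sum_sub_distrib]
  refine Finset.sum_congr rfl fun j _ => Finset.sum_congr rfl fun i _ => ?_
  ring

lemma trace_mul_matFn_sub (g : ℝ → ℝ) {A B X : Matrix d d ℂ} (hB : B.IsHermitian)
    (hA : A.IsHermitian) (hX : X.IsHermitian) (t : ℝ) (h : B - A = t • X) :
    (trace (X * matFn g B)).re - (trace (X * matFn g A)).re =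
      t * spectralForm (divDiff g) hB hA X := by
  have hX' : star X = X := hX
  have h1 := congrArg Complex.re (trace_matFn_mul_matFn g (fun _ => 1) hB hA 1 X)
  have h2 := congrArg Complex.re (trace_matFn_mul_matFn (fun _ => 1) g hB hA 1 X)
  rw [matFn_one hA, Matrix.mul_one, Matrix.mul_one, hX', trace_mul_comm] at h1
  rw [matFn_one hB, Matrix.one_mul, Matrix.one_mul, hX', trace_mul_comm] at h2
  rw [h1, h2]
  simp only [spectralForm, ← Finset.sum_sub_distrib, Complex.re_sum, Finset.mul_sum]
  refine Finset.sum_congr rfl fun j _ => Finset.sum_congr rfl fun i _ => ?_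
  have key := eigMatrix_sub hB hA j i
  rw [h, eigMatrix_smul] at key
  generalize hB.eigenvalues j = b at *
  generalize hA.eigenvalues i = a at *
  generalize eigMatrix hB hA X j i = x at *
  generalize eigMatrix hB hA 1 j i = w at *
  rw [Complex.ext_iff] at key
  simp only [Complex.mul_re, Complex.mul_im, Complex.ofReal_re, Complex.ofReal_im, Complex.sub_re,
    Complex.sub_im, Complex.ofReal_one, Complex.one_re, Complex.one_im, Complex.star_def,
    Complex.conj_re, Complex.conj_im, Complex.normSq_apply, divDiff] at key ⊢
  obtain ⟨k1, k2⟩ := key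
  split_ifs with hab
  · subst hab
    have k1' : t * x.re = 0 := by linarith
    have k2' : t * x.im = 0 := by linarith
    linear_combination (-(deriv g b) * x.re) * k1' - (deriv g b * x.im) * k2'
  · have hab' : b - a ≠ 0 := sub_ne_zero.mpr hab
    field_simp
    linear_combination (-(g b - g a) * x.re) * k1 - ((g b - g a) * x.im) * k2

end Spectral
section Perturbation

open Filter Topology Polynomial

lemma exists_polynomial_derivative_eq (q : ℝ[X]) : ∃ p : ℝ[X], derivative p = q := by
  induction q using Polynomial.induction_on' with
  | add p q hp hq =>
    obtain ⟨p', rfl⟩ := hp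
    obtain ⟨q', rfl⟩ := hq
    exact ⟨p' + q', by simp⟩
  | monomial n a =>
    refine ⟨monomial (n + 1) (a / (n + 1)), ?_⟩
    rw [derivative_monomial]
    congr 1
    push_cast
    field_simp

lemma exists_polynomial_divDiff_near {g : ℝ → ℝ} (hg : ∀ x > 0, DifferentiableAt ℝ g x)
    (hg' : ContinuousOn (deriv g) (Set.Ioi 0)) {m M ε : ℝ} (hm : 0 < m) (hε : 0 < ε) :
    ∃ p : ℝ[X], ∀ x ∈ Set.Icc m M, ∀ y ∈ Set.Icc m M,
      |divDiff g x y - divDiff (fun z => p.eval z) x y| ≤ ε := by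
  obtain ⟨q, hq⟩ := exists_polynomial_near_of_continuousOn m M (deriv g)
    (hg'.mono fun x hx => hm.trans_le hx.1) ε hε
  obtain ⟨p, rfl⟩ := exists_polynomial_derivative_eq q
  refine ⟨p, fun x hx y hy => ?_⟩
  have hd : ∀ z ∈ Set.Icc m M, HasDerivAt (fun z => g z - p.eval z)
      (deriv g z - p.derivative.eval z) z := fun z hz =>
    ((hg z (hm.trans_le hz.1)).hasDerivAt).sub (p.hasDerivAt z)
  have hb : ∀ z ∈ Set.Icc m M, |deriv g z - p.derivative.eval z| ≤ ε := fun z hz => by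
    rw [abs_sub_comm]; exact (hq z hz).le
  unfold divDiff
  split_ifs with hxy
  · rw [p.deriv]; exact hb x hx
  · have h := (convex_Icc m M).norm_image_sub_le_of_norm_hasDerivWithin_le
      (fun z hz => (hd z hz).hasDerivWithinAt) hb hy hx
    rw [Real.norm_eq_abs, Real.norm_eq_abs] at h
    rw [← sub_div, abs_div, div_le_iff₀ (abs_pos.mpr (sub_ne_zero.mpr hxy))]
    rwa [sub_sub_sub_comm] at h

lemma isHermitian_add_smul {d : Type} {A X : Matrix d d ℂ} (hA : A.IsHermitian) (hX : X.IsHermitian)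
    (t : ℝ) : (A + t • X).IsHermitian := by
  refine hA.add ?_
  rw [IsHermitian, conjTranspose_smul, hX.eq]
  simp

variable {d : Type} [Fintype d] [DecidableEq d]

lemma star_mul_matFn_mul_apply (g : ℝ → ℝ) {A : Matrix d d ℂ} (hA : A.IsHermitian)
    (V : Matrix d d ℂ) (j : d) :
    (star V * matFn g A * V) j j = ((∑ i, g (hA.eigenvalues i) *
      Complex.normSq ((star V * (hA.eigenvectorUnitary : Matrix d d ℂ)) j i) : ℝ) : ℂ) := by
  have h : star V * matFn g A * V = star V * (hA.eigenvectorUnitary : Matrix d d ℂ) *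
      diagonal (fun i => (g (hA.eigenvalues i) : ℂ)) *
      star (star V * (hA.eigenvectorUnitary : Matrix d d ℂ)) := by
    rw [matFn_of_isHermitian _ hA, star_mul, star_star]
    simp only [Matrix.mul_assoc]
  rw [h, Matrix.mul_apply]
  push_cast
  refine Finset.sum_congr rfl fun i _ => ?_
  rw [mul_diagonal, star_apply, ← Complex.mul_conj]
  simp only [Complex.star_def]
  ring

lemma star_mul_mul_apply_mem_Icc {A V : Matrix d d ℂ} (hA : A.IsHermitian)
    (hV : star V * V = 1) {m M : ℝ} (h : ∀ i, hA.eigenvalues i ∈ Set.Icc m M) (j : d) :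
    ((star V * A * V) j j).re ∈ Set.Icc m M := by
  have h1 := congrArg Complex.re (star_mul_matFn_mul_apply (fun _ => 1) hA V j)
  have h2 := congrArg Complex.re (star_mul_matFn_mul_apply (fun x => x) hA V j)
  rw [matFn_one hA, Matrix.mul_one, hV, Complex.ofReal_re] at h1
  rw [matFn_id hA, Complex.ofReal_re] at h2
  simp only [one_apply_eq, Complex.one_re, one_mul] at h1
  rw [h2]
  constructor
  · calc m = m * 1 := (mul_one m).symm
      _ ≤ _ := by
        rw [h1, Finset.mul_sum]
        exact Finset.sum_le_sum fun i _ =>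
          mul_le_mul_of_nonneg_right (h i).1 (Complex.normSq_nonneg _)
  · calc _ ≤ M * 1 := by
          rw [h1, Finset.mul_sum]
          exact Finset.sum_le_sum fun i _ =>
            mul_le_mul_of_nonneg_right (h i).2 (Complex.normSq_nonneg _)
      _ = M := mul_one M

lemma eigenvalues_add_smul_mem_Icc {A X : Matrix d d ℂ} (hA : A.IsHermitian)
    (hX : X.IsHermitian) {m M K : ℝ} (h : ∀ i, hA.eigenvalues i ∈ Set.Icc m M)
    (hK : ∀ i, |hX.eigenvalues i| ≤ K) (t : ℝ) (j : d) :
    (isHermitian_add_smul hA hX t).eigenvalues j ∈ Set.Icc (m - |t| * K) (M + |t| * K) := by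
  set hB := isHermitian_add_smul hA hX t
  have hV : star (hB.eigenvectorUnitary : Matrix d d ℂ) * (hB.eigenvectorUnitary : Matrix d d ℂ)
      = 1 := Unitary.coe_star_mul_self _
  have h1 := star_mul_mul_apply_mem_Icc hA hV h j
  have h2 := star_mul_mul_apply_mem_Icc hX hV (m := -K) (M := K) (fun i => abs_le.mp (hK i)) j
  have h3 : ((star (hB.eigenvectorUnitary : Matrix d d ℂ) * (A + t • X) *
      (hB.eigenvectorUnitary : Matrix d d ℂ)) j j).re = hB.eigenvalues j := by
    have h := congrArg Complex.re
      (star_mul_matFn_mul_apply (fun x => x) hB (hB.eigenvectorUnitary : Matrix d d ℂ) j)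
    rw [matFn_id hB, hV, Complex.ofReal_re] at h
    rw [h, Finset.sum_eq_single j]
    · simp
    · intro i _ hij
      simp [one_apply_ne' hij]
    · simp
  rw [Matrix.mul_add, Matrix.add_mul, Matrix.mul_smul, Matrix.smul_mul, Matrix.add_apply,
    Matrix.smul_apply, Complex.add_re, Complex.real_smul, Complex.re_ofReal_mul] at h3
  have h4 : |t * ((star (hB.eigenvectorUnitary : Matrix d d ℂ) * X *
      (hB.eigenvectorUnitary : Matrix d d ℂ)) j j).re| ≤ |t| * K := by
    rw [abs_mul]
    exact mul_le_mul_of_nonneg_left (abs_le.mpr h2) (abs_nonneg t)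
  rw [abs_le] at h4
  rw [← h3]
  exact ⟨by linarith [h1.1], by linarith [h1.2]⟩

lemma exists_eigenvalues_add_smul_mem_Icc {A X : Matrix d d ℂ} (hA : A.PosDef)
    (hX : X.IsHermitian) : ∃ m > 0, ∃ M, ∀ᶠ t : ℝ in 𝓝 0, ∀ j,
      (isHermitian_add_smul hA.isHermitian hX t).eigenvalues j ∈ Set.Icc m M := by
  obtain ⟨M, hM⟩ := (Set.finite_range hA.isHermitian.eigenvalues).bddAbove
  obtain ⟨K, hK⟩ := (Set.finite_range fun i => |hX.eigenvalues i|).bddAbove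
  obtain ⟨m, hm0, hm⟩ : ∃ m > 0, ∀ i, m ≤ hA.isHermitian.eigenvalues i := by
    rcases isEmpty_or_nonempty d with _ | _
    · exact ⟨1, one_pos, fun i => isEmptyElim i⟩
    · obtain ⟨i, hi⟩ := Finite.exists_min hA.isHermitian.eigenvalues
      exact ⟨_, hA.eigenvalues_pos i, hi⟩
  refine ⟨m / 2, half_pos hm0, M + m / 2, ?_⟩
  have hev : ∀ᶠ t : ℝ in 𝓝 0, |t| * K < m / 2 := by
    have : Tendsto (fun t : ℝ => |t| * K) (𝓝 0) (𝓝 (|0| * K)) :=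
      (continuous_abs.mul continuous_const).tendsto 0
    rw [abs_zero, zero_mul] at this
    exact this.eventually_lt_const (half_pos hm0)
  filter_upwards [hev] with t ht j
  have := eigenvalues_add_smul_mem_Icc hA.isHermitian hX
    (fun i => ⟨hm i, hM ⟨i, rfl⟩⟩) (fun i => hK ⟨i, rfl⟩) t j
  exact ⟨by linarith [this.1], by linarith [this.2]⟩

lemma eventually_posDef_add_smul {A X : Matrix d d ℂ} (hA : A.PosDef) (hX : X.IsHermitian) :
    ∀ᶠ t : ℝ in 𝓝 0, (A + t • X).PosDef := by
  obtain ⟨m, hm, M, h⟩ := exists_eigenvalues_add_smul_mem_Icc hA hX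
  filter_upwards [h] with t ht
  rw [(isHermitian_add_smul hA.isHermitian hX t).posDef_iff_eigenvalues_pos]
  exact fun i => hm.trans_le (ht i).1

lemma spectralForm_add (K L : ℝ → ℝ → ℝ) {A B : Matrix d d ℂ} (hB : B.IsHermitian)
    (hA : A.IsHermitian) (X : Matrix d d ℂ) :
    spectralForm (fun b a => K b a + L b a) hB hA X =
      spectralForm K hB hA X + spectralForm L hB hA X := by
  simp only [spectralForm, ← Finset.sum_add_distrib, add_mul]

lemma spectralForm_const_mul (c : ℝ) (K : ℝ → ℝ → ℝ) {A B : Matrix d d ℂ} (hB : B.IsHermitian)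
    (hA : A.IsHermitian) (X : Matrix d d ℂ) :
    spectralForm (fun b a => c * K b a) hB hA X = c * spectralForm K hB hA X := by
  simp only [spectralForm, Finset.mul_sum, mul_assoc]

lemma spectralForm_sum {ι : Type*} (s : Finset ι) (K : ι → ℝ → ℝ → ℝ) {A B : Matrix d d ℂ}
    (hB : B.IsHermitian) (hA : A.IsHermitian) (X : Matrix d d ℂ) :
    spectralForm (fun b a => ∑ l ∈ s, K l b a) hB hA X = ∑ l ∈ s, spectralForm (K l) hB hA X := by
  simp only [spectralForm, Finset.sum_mul]
  rw [Finset.sum_comm]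
  simp_rw [Finset.sum_comm (s := s)]
  rw [Finset.sum_comm]

lemma abs_spectralForm_sub_le {K L : ℝ → ℝ → ℝ} {m M ε : ℝ}
    (h : ∀ x ∈ Set.Icc m M, ∀ y ∈ Set.Icc m M, |K x y - L x y| ≤ ε) {A B : Matrix d d ℂ}
    (hB : B.IsHermitian) (hA : A.IsHermitian) (hBm : ∀ j, hB.eigenvalues j ∈ Set.Icc m M)
    (hAm : ∀ j, hA.eigenvalues j ∈ Set.Icc m M) (X : Matrix d d ℂ) :
    |spectralForm K hB hA X - spectralForm L hB hA X| ≤ ε * (trace (X * star X)).re := by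
  rw [← spectralForm_one X hB hA, ← spectralForm_const_mul]
  simp only [spectralForm, ← Finset.sum_sub_distrib, mul_one, ← sub_mul]
  refine (Finset.abs_sum_le_sum_abs _ _).trans (Finset.sum_le_sum fun j _ => ?_)
  refine (Finset.abs_sum_le_sum_abs _ _).trans (Finset.sum_le_sum fun i _ => ?_)
  rw [abs_mul, abs_of_nonneg (Complex.normSq_nonneg _)]
  exact mul_le_mul_of_nonneg_right (h _ (hBm j) _ (hAm i)) (Complex.normSq_nonneg _)

lemma divDiff_polynomial_add (p q : ℝ[X]) (x y : ℝ) :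
    divDiff (fun z => (p + q).eval z) x y =
      divDiff (fun z => p.eval z) x y + divDiff (fun z => q.eval z) x y := by
  unfold divDiff
  simp only [Polynomial.deriv]
  split_ifs
  · simp
  · simp only [eval_add]; ring

lemma divDiff_monomial (n : ℕ) (c x y : ℝ) :
    divDiff (fun z => (monomial n c).eval z) x y =
      c * ∑ l ∈ Finset.range n, x ^ l * y ^ (n - 1 - l) := by
  unfold divDiff
  simp only [Polynomial.deriv]
  split_ifs with h
  · subst h
    have : ∀ l ∈ Finset.range n, x ^ l * x ^ (n - 1 - l) = x ^ (n - 1) := fun l hl => by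
      rw [← pow_add]
      congr 1
      have := Finset.mem_range.mp hl
      omega
    rw [Finset.sum_congr rfl this]
    simp [derivative_monomial]
    ring
  · rw [div_eq_iff (sub_ne_zero.mpr h), mul_assoc, (Commute.all x y).geom_sum₂_mul]
    simp [mul_sub]

lemma tendsto_spectralForm_pow (l k : ℕ) {A X : Matrix d d ℂ} (hA : A.IsHermitian)
    (hX : X.IsHermitian) :
    Tendsto (fun t : ℝ => spectralForm (fun b a => b ^ l * a ^ k)
      (isHermitian_add_smul hA hX t) hA X) (𝓝 0)
      (𝓝 (spectralForm (fun b a => b ^ l * a ^ k) hA hA X)) := by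
  simp only [spectralForm_pow]
  have : Continuous fun t : ℝ => (trace ((A + t • X) ^ l * X * A ^ k * star X)).re := by
    refine Complex.continuous_re.comp (Continuous.matrix_trace ?_)
    fun_prop
  simpa using this.tendsto 0

lemma tendsto_spectralForm_divDiff_polynomial (p : ℝ[X]) {A X : Matrix d d ℂ}
    (hA : A.IsHermitian) (hX : X.IsHermitian) :
    Tendsto (fun t : ℝ => spectralForm (divDiff fun z => p.eval z)
      (isHermitian_add_smul hA hX t) hA X) (𝓝 0)
      (𝓝 (spectralForm (divDiff fun z => p.eval z) hA hA X)) := by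
  induction p using Polynomial.induction_on' with
  | add p q hp hq =>
    have : (divDiff fun z => (p + q).eval z) = fun x y =>
      divDiff (fun z => p.eval z) x y + divDiff (fun z => q.eval z) x y := by
      ext x y; exact divDiff_polynomial_add p q x y
    simp only [this, spectralForm_add]
    exact hp.add hq
  | monomial n c =>
    have : (divDiff fun z => (monomial n c).eval z) = fun x y =>
      c * ∑ l ∈ Finset.range n, x ^ l * y ^ (n - 1 - l) := by
      ext x y; exact divDiff_monomial n c x y
    simp only [this, spectralForm_const_mul, spectralForm_sum]
    exact (tendsto_finsetSum _ fun l _ => tendsto_spectralForm_pow _ _ hA hX).const_mul c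

lemma tendsto_spectralForm_divDiff {g : ℝ → ℝ} (hg : ∀ x > 0, DifferentiableAt ℝ g x)
    (hg' : ContinuousOn (deriv g) (Set.Ioi 0)) {A X : Matrix d d ℂ} (hA : A.PosDef)
    (hX : X.IsHermitian) :
    Tendsto (fun t : ℝ => spectralForm (divDiff g)
      (isHermitian_add_smul hA.isHermitian hX t) hA.isHermitian X) (𝓝 0)
      (𝓝 (spectralForm (divDiff g) hA.isHermitian hA.isHermitian X)) := by
  obtain ⟨m, hm, M, hmM⟩ := exists_eigenvalues_add_smul_mem_Icc hA hX
  have hmA : ∀ j, hA.isHermitian.eigenvalues j ∈ Set.Icc m M := by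
    simpa using hmM.self_of_nhds
  set c := (trace (X * star X)).re with hc
  have hc0 : 0 ≤ c := by
    rw [hc, ← spectralForm_one X hA.isHermitian hA.isHermitian]
    exact Finset.sum_nonneg fun j _ => Finset.sum_nonneg fun i _ =>
      mul_nonneg zero_le_one (Complex.normSq_nonneg _)
  rw [Metric.tendsto_nhds]
  intro ε hε
  have hδ : 0 < ε / (3 * (c + 1)) := by positivity
  obtain ⟨p, hp⟩ := exists_polynomial_divDiff_near hg hg' (M := M) hm hδ
  have hδc : ε / (3 * (c + 1)) * c < ε / 3 := by
    rw [div_mul_eq_mul_div, div_lt_div_iff₀ (by positivity) (by positivity)]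
    nlinarith
  have hpt := Metric.tendsto_nhds.mp
    (tendsto_spectralForm_divDiff_polynomial p hA.isHermitian hX) (ε / 3) (by positivity)
  filter_upwards [hmM, hpt] with t ht1 ht2
  rw [Real.dist_eq] at ht2 ⊢
  have h1 := abs_spectralForm_sub_le hp (isHermitian_add_smul hA.isHermitian hX t)
    hA.isHermitian ht1 hmA X
  have h2 := abs_spectralForm_sub_le hp hA.isHermitian hA.isHermitian hmA hmA X
  rw [abs_le] at h1 h2
  rw [abs_lt] at ht2 ⊢
  constructor <;> linarith [h1.1, h1.2, h2.1, h2.2, ht2.1, ht2.2]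

lemma hasDerivAt_trace_mul_matFn_zero {g : ℝ → ℝ} (hg : ∀ x > 0, DifferentiableAt ℝ g x)
    (hg' : ContinuousOn (deriv g) (Set.Ioi 0)) {A X : Matrix d d ℂ} (hA : A.PosDef)
    (hX : X.IsHermitian) :
    HasDerivAt (fun t : ℝ => (trace (X * matFn g (A + t • X))).re)
      (spectralForm (divDiff g) hA.isHermitian hA.isHermitian X) 0 := by
  rw [hasDerivAt_iff_tendsto_slope]
  refine ((tendsto_spectralForm_divDiff hg hg' hA hX).mono_left nhdsWithin_le_nhds).congr' ?_
  filter_upwards [self_mem_nhdsWithin] with t ht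
  have h := trace_mul_matFn_sub g (isHermitian_add_smul hA.isHermitian hX t) hA.isHermitian hX t
    (by simp)
  rw [slope_def_field, zero_smul, add_zero, h, sub_zero, mul_div_cancel_left₀ _ ht]

lemma convexOn_le_sub {f : ℝ → ℝ} (hf : ConvexOn ℝ (Set.Ioi 0) f) {a b : ℝ} (ha : 0 < a)
    (hb : 0 < b) (hd : DifferentiableAt ℝ f a) : 0 ≤ f b - f a - deriv f a * (b - a) := by
  rcases lt_trichotomy a b with h | rfl | h
  · have := hf.deriv_le_slope ha hb h hd
    rw [slope_def_field, le_div_iff₀ (sub_pos.mpr h)] at this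
    linarith
  · simp
  · have := hf.slope_le_deriv hb ha h hd
    rw [slope_def_field, div_le_iff₀ (sub_pos.mpr h)] at this
    linarith

/-- Klein's inequality. -/
lemma trace_mul_matFn_deriv_le {f : ℝ → ℝ} (hf : ConvexOn ℝ (Set.Ioi 0) f)
    (hd : ∀ x > 0, DifferentiableAt ℝ f x) {A B : Matrix d d ℂ} (hB : B.PosDef) (hA : A.PosDef) :
    (trace ((B - A) * matFn (deriv f) A)).re ≤ trFn f B - trFn f A := by
  rw [← sub_nonneg, trFn_sub_sub f (deriv f) hB.isHermitian hA.isHermitian]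
  exact Finset.sum_nonneg fun j _ => Finset.sum_nonneg fun i _ => mul_nonneg
    (convexOn_le_sub hf (hA.eigenvalues_pos i) (hB.eigenvalues_pos j)
      (hd _ (hA.eigenvalues_pos i))) (Complex.normSq_nonneg _)

lemma hasDerivAt_trFn_zero {f : ℝ → ℝ} (hf : ConvexOn ℝ (Set.Ioi 0) f)
    (hd : ∀ x > 0, DifferentiableAt ℝ f x) (hg : ∀ x > 0, DifferentiableAt ℝ (deriv f) x)
    (hg' : ContinuousOn (deriv (deriv f)) (Set.Ioi 0)) {A X : Matrix d d ℂ} (hA : A.PosDef)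
    (hX : X.IsHermitian) :
    HasDerivAt (fun t : ℝ => trFn f (A + t • X)) (trace (X * matFn (deriv f) A)).re 0 := by
  have hG := (hasDerivAt_trace_mul_matFn_zero hg hg' hA hX).continuousAt.tendsto
  simp only [zero_smul, add_zero] at hG
  rw [hasDerivAt_iff_isLittleO, Asymptotics.isLittleO_iff]
  intro c hc
  filter_upwards [eventually_posDef_add_smul hA hX, Metric.tendsto_nhds.mp hG c hc] with t ht h
  rw [Real.dist_eq] at h
  have h1 := trace_mul_matFn_deriv_le hf hd ht hA
  have h2 := trace_mul_matFn_deriv_le hf hd hA ht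
  rw [add_sub_cancel_left, Matrix.smul_mul, trace_smul, Complex.real_smul,
    Complex.re_ofReal_mul] at h1
  rw [sub_add_cancel_left, Matrix.neg_mul, Matrix.smul_mul, trace_neg, trace_smul,
    Complex.real_smul, Complex.neg_re, Complex.re_ofReal_mul] at h2
  simp only [zero_smul, add_zero, sub_zero, Real.norm_eq_abs, smul_eq_mul]
  rw [abs_of_nonneg (by linarith)]
  calc _ ≤ t * ((trace (X * matFn (deriv f) (A + t • X))).re -
        (trace (X * matFn (deriv f) A)).re) := by linarith
    _ ≤ |t| * c := (le_abs_self _).trans (by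
        rw [abs_mul]; exact mul_le_mul_of_nonneg_left h.le (abs_nonneg t))
    _ = c * |t| := mul_comm _ _

lemma hasDerivAt_trFn {f : ℝ → ℝ} (hf : ConvexOn ℝ (Set.Ioi 0) f)
    (hd : ∀ x > 0, DifferentiableAt ℝ f x) (hg : ∀ x > 0, DifferentiableAt ℝ (deriv f) x)
    (hg' : ContinuousOn (deriv (deriv f)) (Set.Ioi 0)) {A X : Matrix d d ℂ} {t : ℝ}
    (hA : (A + t • X).PosDef) (hX : X.IsHermitian) :
    HasDerivAt (fun t : ℝ => trFn f (A + t • X))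
      (trace (X * matFn (deriv f) (A + t • X))).re t := by
  have h := (hasDerivAt_trFn_zero hf hd hg hg' hA hX)
  rw [← sub_self t] at h
  have h' := h.comp_sub_const t t
  simpa only [add_assoc, ← add_smul, add_sub_cancel] using h'

lemma hasDerivAt_trace_mul_matFn {g : ℝ → ℝ} (hg : ∀ x > 0, DifferentiableAt ℝ g x)
    (hg' : ContinuousOn (deriv g) (Set.Ioi 0)) {A X : Matrix d d ℂ} {t : ℝ}
    (hA : (A + t • X).PosDef) (hX : X.IsHermitian) :
    HasDerivAt (fun t : ℝ => (trace (X * matFn g (A + t • X))).re)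
      (spectralForm (divDiff g) hA.isHermitian hA.isHermitian X) t := by
  have h := (hasDerivAt_trace_mul_matFn_zero hg hg' hA hX)
  rw [← sub_self t] at h
  have h' := h.comp_sub_const t t
  simpa only [add_assoc, ← add_smul, add_sub_cancel] using h'

end Perturbation
section Superoperator

variable {n : ℕ}

/-- A superoperator that is symmetric and positive for the trace inner product and commutes with
taking adjoints. -/
structure IsPositiveEnd (T : Module.End ℂ (Matrix (Fin n) (Fin n) ℂ)) : Prop where
  symm : ∀ x y, trace (star (T x) * y) = trace (star x * T y)
  nonneg : ∀ x, 0 ≤ (trace (star x * T x)).re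
  map_star : ∀ x, T (star x) = star (T x)

lemma re_trace_star_mul_comm (x y : Matrix (Fin n) (Fin n) ℂ) :
    (trace (star x * y)).re = (trace (star y * x)).re := by
  have h : star (trace (star x * y)) = trace (star y * x) := by
    rw [star_eq_conjTranspose, ← trace_conjTranspose, conjTranspose_mul,
      conjTranspose_conjTranspose, star_eq_conjTranspose]
  rw [← h]
  exact (Complex.conj_re _).symm

namespace IsPositiveEnd

variable {T A B C Ai Bi Ci : Module.End ℂ (Matrix (Fin n) (Fin n) ℂ)}

lemma im_trace (hT : IsPositiveEnd T) (x : Matrix (Fin n) (Fin n) ℂ) :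
    (trace (star (T x) * x)).im = 0 := by
  have h : star (trace (star (T x) * x)) = trace (star x * T x) := by
    rw [star_eq_conjTranspose, ← trace_conjTranspose, conjTranspose_mul,
      conjTranspose_conjTranspose, star_eq_conjTranspose]
  rw [← hT.symm] at h
  exact Complex.conj_eq_iff_im.mp h

/-- Polarised positivity: `⟨s - z, T (s - z)⟩ ≥ 0`. -/
lemma two_mul_le (hT : IsPositiveEnd T) (s z : Matrix (Fin n) (Fin n) ℂ) :
    2 * (trace (star s * T z)).re ≤ (trace (star s * T s)).re + (trace (star z * T z)).re := by
  have h := hT.nonneg (s - z)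
  have h1 : (trace (star z * T s)).re = (trace (star s * T z)).re := by
    rw [re_trace_star_mul_comm, hT.symm]
  simp only [star_sub, map_sub, Matrix.sub_mul, Matrix.mul_sub, trace_sub, Complex.sub_re, h1] at h
  linarith

lemma four_mul_re_trace (hT : IsPositiveEnd T) (x : Matrix (Fin n) (Fin n) ℂ) :
    4 * (trace (star x * T x)).re =
      (trace (star (x + star x) * T (x + star x))).re +
        (trace (star (Complex.I • (x - star x)) * T (Complex.I • (x - star x)))).re := by
  have h1 : (trace (x * star (T x))).re = (trace (star x * T x)).re := by
    rw [trace_mul_comm, re_trace_star_mul_comm]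
  simp only [star_add, star_sub, star_star, star_smul, map_add, map_sub, map_smul, hT.map_star,
    Matrix.add_mul, Matrix.mul_add, Matrix.sub_mul, Matrix.mul_sub, Matrix.smul_mul,
    Matrix.mul_smul, trace_add, trace_sub, trace_smul, smul_smul, Complex.add_re, Complex.sub_re,
    smul_sub, h1]
  simp
  linarith [h1]

/-- Hermitian arguments suffice to test a comparison of positive superoperators. -/
lemma le_add_of_isHermitian (hA : IsPositiveEnd A) (hB : IsPositiveEnd B) (hC : IsPositiveEnd C)
    (h : ∀ x y : Matrix (Fin n) (Fin n) ℂ, x.IsHermitian → y.IsHermitian →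
      (trace (star (x + y) * C (x + y))).re ≤
        (trace (star x * A x)).re + (trace (star y * B y)).re)
    (x y : Matrix (Fin n) (Fin n) ℂ) :
    (trace (star (x + y) * C (x + y))).re ≤
      (trace (star x * A x)).re + (trace (star y * B y)).re := by
  have hre (z : Matrix (Fin n) (Fin n) ℂ) : (z + star z).IsHermitian :=
    isHermitian_add_transpose_self z
  have him (z : Matrix (Fin n) (Fin n) ℂ) : (Complex.I • (z - star z)).IsHermitian := by
    rw [IsHermitian, ← star_eq_conjTranspose, star_smul, star_sub, star_star, Complex.star_def,
      Complex.conj_I, neg_smul, ← smul_neg, neg_sub]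
  have h1 := h _ _ (hre x) (hre y)
  have h2 := h _ _ (him x) (him y)
  have e1 : x + star x + (y + star y) = (x + y) + star (x + y) := by rw [star_add]; abel
  have e2 : Complex.I • (x - star x) + Complex.I • (y - star y) =
      Complex.I • ((x + y) - star (x + y)) := by rw [← smul_add, star_add]; congr 1; abel
  rw [e1] at h1
  rw [e2] at h2
  have hx := hA.four_mul_re_trace x
  have hy := hB.four_mul_re_trace y
  have hxy := hC.four_mul_re_trace (x + y)
  linarith

/-- `C ≤` the parallel sum of `A` and `B` iff `C⁻¹ ≥ A⁻¹ + B⁻¹`. -/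
lemma le_add_iff_endLE_inverse (hA : IsPositiveEnd A) (hB : IsPositiveEnd B)
    (hC : IsPositiveEnd C) (hAi : IsUnit A) (hBi : IsUnit B) (hCi : IsUnit C) :
    (∀ x y : Matrix (Fin n) (Fin n) ℂ, (trace (star (x + y) * C (x + y))).re ≤
      (trace (star x * A x)).re + (trace (star y * B y)).re) ↔
    endLE (Ring.inverse A + Ring.inverse B) (Ring.inverse C) := by
  have cancel {T : Module.End ℂ (Matrix (Fin n) (Fin n) ℂ)} (hT : IsUnit T) (h) :
      T (Ring.inverse T h) = h := LinearMap.congr_fun (Ring.mul_inverse_cancel T hT) h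
  have realOf {T : Module.End ℂ (Matrix (Fin n) (Fin n) ℂ)} (hT : IsPositiveEnd T)
      (hTi : IsUnit T) (h) : (trace (star h * Ring.inverse T h)).im = 0 := by
    have := hT.im_trace (Ring.inverse T h)
    rwa [cancel hTi] at this
  constructor
  · intro H h
    rw [Complex.nonneg_iff]
    rw [LinearMap.add_apply, Matrix.mul_sub, Matrix.mul_add, trace_sub, trace_add]
    constructor
    · have h1 := H (Ring.inverse A h) (Ring.inverse B h)
      have h2 := hC.two_mul_le (Ring.inverse A h + Ring.inverse B h) (Ring.inverse C h)
      rw [cancel hAi, cancel hBi] at h1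
      rw [cancel hCi] at h2
      have h3 : (trace (star (Ring.inverse A h + Ring.inverse B h) * h)).re =
        (trace (star (Ring.inverse A h) * h)).re + (trace (star (Ring.inverse B h) * h)).re := by
        rw [star_add, Matrix.add_mul, trace_add, Complex.add_re]
      rw [Complex.sub_re, Complex.add_re, re_trace_star_mul_comm h, re_trace_star_mul_comm h,
        re_trace_star_mul_comm h]
      linarith
    · rw [Complex.sub_im, Complex.add_im, realOf hA hAi, realOf hB hBi, realOf hC hCi]
      simp
  · intro H x y
    have h1 := (Complex.nonneg_iff.mp (H (C (x + y)))).1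
    have hCx : Ring.inverse C (C (x + y)) = x + y :=
      LinearMap.congr_fun (Ring.inverse_mul_cancel C hCi) (x + y)
    set h := C (x + y) with hh
    rw [LinearMap.add_apply, Matrix.mul_sub, Matrix.mul_add, trace_sub, trace_add, Complex.sub_re,
      Complex.add_re, re_trace_star_mul_comm h, re_trace_star_mul_comm h,
      re_trace_star_mul_comm h, hCx] at h1
    have h2 := hA.two_mul_le x (Ring.inverse A h)
    have h3 := hB.two_mul_le y (Ring.inverse B h)
    rw [cancel hAi] at h2
    rw [cancel hBi] at h3
    have h4 : (trace (star (x + y) * h)).re =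
        (trace (star x * h)).re + (trace (star y * h)).re := by
      rw [star_add, Matrix.add_mul, trace_add, Complex.add_re]
    linarith

end IsPositiveEnd

/-- In an orthonormal basis given by the columns of `U`, entrywise multiplication by `L`. -/
def schurEnd (U : Matrix (Fin n) (Fin n) ℂ) (L : Fin n → Fin n → ℝ) :
    Module.End ℂ (Matrix (Fin n) (Fin n) ℂ) :=
  (conjEnd U).comp ((hadamardEnd (Matrix.of fun i j => (L i j : ℂ))).comp (conjEnd (star U)))

lemma schurEnd_apply (U : Matrix (Fin n) (Fin n) ℂ) (L : Fin n → Fin n → ℝ)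
    (x : Matrix (Fin n) (Fin n) ℂ) :
    schurEnd U L x = U * ((Matrix.of fun i j => (L i j : ℂ)) ⊙ (star U * x * U)) * star U := by
  simp [schurEnd, conjEnd, hadamardEnd, Matrix.mul_assoc]

lemma schurEnd_mul {U : Matrix (Fin n) (Fin n) ℂ} (hU : star U * U = 1)
    (L L' : Fin n → Fin n → ℝ) :
    schurEnd U L * schurEnd U L' = schurEnd U (fun i j => L i j * L' i j) := by
  refine LinearMap.ext fun x => ?_
  rw [Module.End.mul_apply, schurEnd_apply, schurEnd_apply, schurEnd_apply]
  have : ∀ Z, star U * (U * Z * star U) * U = Z := fun Z => by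
    calc star U * (U * Z * star U) * U = (star U * U) * Z * (star U * U) := by
          simp only [Matrix.mul_assoc]
      _ = Z := by rw [hU, Matrix.one_mul, Matrix.mul_one]
  rw [this]
  congr 2
  ext i j
  simp [hadamard_apply, mul_assoc]

lemma schurEnd_one {U : Matrix (Fin n) (Fin n) ℂ} (hU : star U * U = 1) :
    schurEnd U (fun _ _ => 1) = 1 := by
  have hU' : U * star U = 1 := mul_eq_one_comm.mp hU
  refine LinearMap.ext fun x => ?_
  rw [schurEnd_apply, Module.End.one_apply]
  have : (Matrix.of fun (_ _ : Fin n) => ((1 : ℝ) : ℂ)) ⊙ (star U * x * U) = star U * x * U := by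
    ext i j
    simp [hadamard_apply]
  rw [this]
  calc U * (star U * x * U) * star U = (U * star U) * x * (U * star U) := by
        simp only [Matrix.mul_assoc]
    _ = x := by rw [hU', Matrix.one_mul, Matrix.mul_one]

lemma isUnit_schurEnd {U : Matrix (Fin n) (Fin n) ℂ} (hU : star U * U = 1)
    {L : Fin n → Fin n → ℝ} (hL : ∀ i j, 0 < L i j) : IsUnit (schurEnd U L) := by
  refine ⟨⟨schurEnd U L, schurEnd U fun i j => (L i j)⁻¹, ?_, ?_⟩, rfl⟩ <;>
    rw [schurEnd_mul hU, ← schurEnd_one hU] <;> congr 1 <;> ext i j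
  · exact mul_inv_cancel₀ (hL i j).ne'
  · exact inv_mul_cancel₀ (hL i j).ne'

lemma trace_star_mul_schurEnd (U : Matrix (Fin n) (Fin n) ℂ) (L : Fin n → Fin n → ℝ)
    (x y : Matrix (Fin n) (Fin n) ℂ) :
    trace (star x * schurEnd U L y) =
      ∑ i, ∑ j, star ((star U * x * U) i j) * (L i j * (star U * y * U) i j) := by
  have h : trace (star x * schurEnd U L y) = trace (star (star U * x * U) *
      ((Matrix.of fun i j => (L i j : ℂ)) ⊙ (star U * y * U))) := by
    rw [schurEnd_apply]
    simp only [star_mul, star_star, Matrix.mul_assoc]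
    rw [Matrix.trace_mul_comm (star U)]
    simp only [Matrix.mul_assoc]
  rw [h]
  generalize star U * x * U = P
  generalize star U * y * U = Q
  rw [trace, Finset.sum_comm]
  simp [Matrix.mul_apply, star_apply, hadamard_apply]

lemma star_schurEnd (U : Matrix (Fin n) (Fin n) ℂ) {L : Fin n → Fin n → ℝ}
    (hL : ∀ i j, L i j = L j i) (x : Matrix (Fin n) (Fin n) ℂ) :
    schurEnd U L (star x) = star (schurEnd U L x) := by
  rw [schurEnd_apply, schurEnd_apply]
  have h : star U * star x * U = star (star U * x * U) := by
    simp only [star_mul, star_star, Matrix.mul_assoc]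
  have h' (P : Matrix (Fin n) (Fin n) ℂ) : (Matrix.of fun i j => (L i j : ℂ)) ⊙ star P =
      star ((Matrix.of fun i j => (L i j : ℂ)) ⊙ P) := by
    ext i j
    simp [hadamard_apply, star_apply, hL i j]
  rw [h, h']
  simp only [star_mul, star_star, Matrix.mul_assoc]

lemma re_trace_star_mul_schurEnd_self (U : Matrix (Fin n) (Fin n) ℂ) (L : Fin n → Fin n → ℝ)
    (x : Matrix (Fin n) (Fin n) ℂ) :
    (trace (star x * schurEnd U L x)).re =
      ∑ i, ∑ j, L i j * Complex.normSq ((star U * x * U) i j) := by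
  rw [trace_star_mul_schurEnd]
  simp only [Complex.re_sum]
  refine Finset.sum_congr rfl fun i _ => Finset.sum_congr rfl fun j _ => ?_
  simp [Complex.normSq_apply]
  ring

lemma isPositiveEnd_schurEnd (U : Matrix (Fin n) (Fin n) ℂ) {L : Fin n → Fin n → ℝ}
    (hL : ∀ i j, 0 ≤ L i j) (hL' : ∀ i j, L i j = L j i) : IsPositiveEnd (schurEnd U L) where
  symm x y := by
    have h : trace (star (schurEnd U L x) * y) = star (trace (star y * schurEnd U L x)) := by
      rw [star_eq_conjTranspose, star_eq_conjTranspose, ← trace_conjTranspose, conjTranspose_mul,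
        conjTranspose_conjTranspose]
    rw [h, trace_star_mul_schurEnd, trace_star_mul_schurEnd]
    simp only [star_sum]
    refine Finset.sum_congr rfl fun i _ => Finset.sum_congr rfl fun j _ => ?_
    simp
    ring
  nonneg x := by
    rw [re_trace_star_mul_schurEnd_self]
    exact Finset.sum_nonneg fun i _ => Finset.sum_nonneg fun j _ =>
      mul_nonneg (hL i j) (Complex.normSq_nonneg _)
  map_star := star_schurEnd U hL'

lemma divDiff_comm (g : ℝ → ℝ) (x y : ℝ) : divDiff g x y = divDiff g y x := by
  unfold divDiff
  split_ifs with h1 h2 h2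
  · rw [h1]
  · exact absurd h1.symm h2
  · exact absurd h2.symm h1
  · rw [← neg_sub (g y), ← neg_sub y, neg_div_neg_eq]

lemma divDiff_pos {g : ℝ → ℝ} (hc : ContinuousOn g (Set.Ioi 0))
    (hg : ∀ x > 0, 0 < deriv g x) {x y : ℝ} (hx : 0 < x) (hy : 0 < y) : 0 < divDiff g x y := by
  have hmono : StrictMonoOn g (Set.Ioi 0) := strictMonoOn_of_deriv_pos (convex_Ioi 0) hc
    fun z hz => hg z (by simpa using hz)
  unfold divDiff
  split_ifs with h
  · exact hg x hx
  · rcases lt_or_gt_of_ne h with h | h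
    · exact div_pos_of_neg_of_neg (sub_neg.mpr (hmono hx hy h)) (sub_neg.mpr h)
    · exact div_pos (sub_pos.mpr (hmono hy hx h)) (sub_pos.mpr h)

lemma frechetDiff_eq_schurEnd (g : ℝ → ℝ) {ρ : Matrix (Fin n) (Fin n) ℂ} (hρ : ρ.IsHermitian) :
    frechetDiff g ρ = schurEnd (hρ.eigenvectorUnitary : Matrix (Fin n) (Fin n) ℂ)
      (fun i j => divDiff g (hρ.eigenvalues i) (hρ.eigenvalues j)) := dif_pos hρ

lemma re_trace_star_mul_frechetDiff (g : ℝ → ℝ) {ρ : Matrix (Fin n) (Fin n) ℂ}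
    (hρ : ρ.IsHermitian) (x : Matrix (Fin n) (Fin n) ℂ) :
    (trace (star x * frechetDiff g ρ x)).re = spectralForm (divDiff g) hρ hρ x := by
  rw [frechetDiff_eq_schurEnd g hρ, re_trace_star_mul_schurEnd_self]
  rfl

variable {g : ℝ → ℝ} {ρ : Matrix (Fin n) (Fin n) ℂ}

lemma isPositiveEnd_frechetDiff (hc : ContinuousOn g (Set.Ioi 0))
    (hg : ∀ x > 0, 0 < deriv g x) (hρ : ρ.PosDef) : IsPositiveEnd (frechetDiff g ρ) := by
  rw [frechetDiff_eq_schurEnd g hρ.isHermitian]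
  exact isPositiveEnd_schurEnd _
    (fun i j => (divDiff_pos hc hg (hρ.eigenvalues_pos i) (hρ.eigenvalues_pos j)).le)
    fun i j => divDiff_comm _ _ _

lemma isUnit_frechetDiff (hc : ContinuousOn g (Set.Ioi 0))
    (hg : ∀ x > 0, 0 < deriv g x) (hρ : ρ.PosDef) : IsUnit (frechetDiff g ρ) := by
  rw [frechetDiff_eq_schurEnd g hρ.isHermitian]
  exact isUnit_schurEnd (Unitary.coe_star_mul_self _)
    fun i j => divDiff_pos hc hg (hρ.eigenvalues_pos i) (hρ.eigenvalues_pos j)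

end Superoperator

section Convexity

lemma add_smul_pair {d : Type} (A B X Y : Matrix d d ℂ) (t : ℝ) :
    A + t • X + (B + t • Y) = A + B + t • (X + Y) := by
  rw [smul_add]; abel

lemma smul_add_smul_eq_add_smul_sub {d : Type} (A A' : Matrix d d ℂ) {a b : ℝ} (hab : a + b = 1) :
    a • A + b • A' = A + b • (A' - A) := by
  rw [eq_sub_of_add_eq hab, sub_smul, one_smul, smul_sub]; abel

lemma posDef_add_smul_sub {d : Type} {A A' : Matrix d d ℂ} (hA : A.PosDef) (hA' : A'.PosDef) {t : ℝ}
    (ht : t ∈ Set.Icc (0 : ℝ) 1) : (A + t • (A' - A)).PosDef := by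
  rw [← smul_add_smul_eq_add_smul_sub A A' (sub_add_cancel 1 t)]
  rcases ht.1.eq_or_lt with rfl | ht0
  · simpa
  · exact PosDef.posSemidef_add (hA.posSemidef.smul (sub_nonneg.mpr ht.2)) (hA'.smul ht0)

lemma posDef_smul_add_smul {d : Type} {A A' : Matrix d d ℂ} (hA : A.PosDef) (hA' : A'.PosDef) {a b : ℝ}
    (ha : 0 ≤ a) (hb : 0 ≤ b) (hab : a + b = 1) : (a • A + b • A').PosDef :=
  smul_add_smul_eq_add_smul_sub A A' hab ▸ posDef_add_smul_sub hA hA' ⟨hb, by linarith⟩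

lemma convex_setOf_posDef_pair {d : Type} :
    Convex ℝ {p : Matrix d d ℂ × Matrix d d ℂ | p.1.PosDef ∧ p.2.PosDef} :=
  fun _ hp _ hq _ _ ha hb hab =>
    ⟨posDef_smul_add_smul hp.1 hq.1 ha hb hab, posDef_smul_add_smul hp.2 hq.2 ha hb hab⟩

variable {f : ℝ → ℝ} {d : Type} [Fintype d] [DecidableEq d]

/-- The function whose convexity is subentropicity of order two. -/
def pairGap (f : ℝ → ℝ) (p : Matrix d d ℂ × Matrix d d ℂ) : ℝ :=
  trFn f p.1 + trFn f p.2 - trFn f (p.1 + p.2)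

lemma hasDerivAt_pairGap
    (hf : ConvexOn ℝ (Set.Ioi 0) f)
    (hd : ∀ x > 0, DifferentiableAt ℝ f x) (hg : ∀ x > 0, DifferentiableAt ℝ (deriv f) x)
    (hg' : ContinuousOn (deriv (deriv f)) (Set.Ioi 0)) {A B X Y : Matrix d d ℂ} {t : ℝ}
    (hA : (A + t • X).PosDef) (hB : (B + t • Y).PosDef) (hX : X.IsHermitian)
    (hY : Y.IsHermitian) :
    HasDerivAt (fun t : ℝ => pairGap f (A + t • X, B + t • Y))
      ((trace (X * matFn (deriv f) (A + t • X))).re + (trace (Y * matFn (deriv f) (B + t • Y))).re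
        - (trace ((X + Y) * matFn (deriv f) (A + B + t • (X + Y)))).re) t := by
  have hAB : (A + B + t • (X + Y)).PosDef := add_smul_pair A B X Y t ▸ hA.add hB
  simp only [pairGap, add_smul_pair]
  exact ((hasDerivAt_trFn hf hd hg hg' hA hX).add (hasDerivAt_trFn hf hd hg hg' hB hY)).sub
    (hasDerivAt_trFn hf hd hg hg' hAB (hX.add hY))

lemma hasDerivAt_deriv_pairGap
    (hg : ∀ x > 0, DifferentiableAt ℝ (deriv f) x)
    (hg' : ContinuousOn (deriv (deriv f)) (Set.Ioi 0)) {A B X Y : Matrix d d ℂ} {t : ℝ}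
    (hA : (A + t • X).PosDef) (hB : (B + t • Y).PosDef) (hAB : (A + B + t • (X + Y)).PosDef)
    (hX : X.IsHermitian) (hY : Y.IsHermitian) :
    HasDerivAt (fun t : ℝ => (trace (X * matFn (deriv f) (A + t • X))).re +
        (trace (Y * matFn (deriv f) (B + t • Y))).re
        - (trace ((X + Y) * matFn (deriv f) (A + B + t • (X + Y)))).re)
      (spectralForm (divDiff (deriv f)) hA.isHermitian hA.isHermitian X +
        spectralForm (divDiff (deriv f)) hB.isHermitian hB.isHermitian Y -
        spectralForm (divDiff (deriv f)) hAB.isHermitian hAB.isHermitian (X + Y)) t :=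
  ((hasDerivAt_trace_mul_matFn hg hg' hA hX).add (hasDerivAt_trace_mul_matFn hg hg' hB hY)).sub
    (hasDerivAt_trace_mul_matFn hg hg' hAB (hX.add hY))

lemma convexOn_pairGap
    (hf : ConvexOn ℝ (Set.Ioi 0) f)
    (hd : ∀ x > 0, DifferentiableAt ℝ f x) (hg : ∀ x > 0, DifferentiableAt ℝ (deriv f) x)
    (hg' : ContinuousOn (deriv (deriv f)) (Set.Ioi 0))
    (H : ∀ (A B : Matrix d d ℂ) (hA : A.PosDef) (hB : B.PosDef) (X Y : Matrix d d ℂ),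
      X.IsHermitian → Y.IsHermitian →
      spectralForm (divDiff (deriv f)) (hA.add hB).isHermitian (hA.add hB).isHermitian (X + Y) ≤
        spectralForm (divDiff (deriv f)) hA.isHermitian hA.isHermitian X +
        spectralForm (divDiff (deriv f)) hB.isHermitian hB.isHermitian Y) :
    ConvexOn ℝ {p : Matrix d d ℂ × Matrix d d ℂ | p.1.PosDef ∧ p.2.PosDef} (pairGap f) := by
  refine ⟨convex_setOf_posDef_pair, ?_⟩
  rintro ⟨A, B⟩ ⟨hA, hB⟩ ⟨A', B'⟩ ⟨hA', hB'⟩ a b ha hb hab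
  have hX := hA'.isHermitian.sub hA.isHermitian
  have hY := hB'.isHermitian.sub hB.isHermitian
  have key : ConvexOn ℝ (Set.Icc (0 : ℝ) 1)
      (fun t : ℝ => pairGap f (A + t • (A' - A), B + t • (B' - B))) := by
    have hD : ∀ t ∈ Set.Icc (0 : ℝ) 1, _ := fun t ht =>
      hasDerivAt_pairGap hf hd hg hg' (posDef_add_smul_sub hA hA' ht)
        (posDef_add_smul_sub hB hB' ht) hX hY
    have hAB : ∀ t ∈ Set.Icc (0 : ℝ) 1, (A + B + t • (A' - A + (B' - B))).PosDef := fun t ht =>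
      add_smul_pair A B (A' - A) (B' - B) t ▸
        (posDef_add_smul_sub hA hA' ht).add (posDef_add_smul_sub hB hB' ht)
    have hD2 : ∀ t, ∀ ht : t ∈ Set.Icc (0 : ℝ) 1, _ := fun t ht =>
      hasDerivAt_deriv_pairGap hg hg' (posDef_add_smul_sub hA hA' ht)
        (posDef_add_smul_sub hB hB' ht) (hAB t ht) hX hY
    refine convexOn_of_hasDerivWithinAt2_nonneg (f'' := deriv _) (convex_Icc 0 1)
      (fun t ht => (hD t ht).continuousAt.continuousWithinAt)
      (fun t ht => (hD t (interior_subset ht)).hasDerivWithinAt)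
      (fun t ht => (hD2 t (interior_subset ht)).differentiableAt.hasDerivAt.hasDerivWithinAt)
      fun t ht => ?_
    have ht' := interior_subset ht
    rw [(hD2 t ht').deriv, sub_nonneg]
    have h := H _ _ (posDef_add_smul_sub hA hA' ht') (posDef_add_smul_sub hB hB' ht') _ _ hX hY
    simpa only [add_smul_pair] using h
  have h := key.2 (Set.left_mem_Icc.mpr zero_le_one) (Set.right_mem_Icc.mpr zero_le_one)
    ha hb hab
  simpa [← smul_add_smul_eq_add_smul_sub _ _ hab] using h

lemma spectralForm_le_of_convexOn_pairGap
    (hf : ConvexOn ℝ (Set.Ioi 0) f)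
    (hd : ∀ x > 0, DifferentiableAt ℝ f x) (hg : ∀ x > 0, DifferentiableAt ℝ (deriv f) x)
    (hg' : ContinuousOn (deriv (deriv f)) (Set.Ioi 0))
    (H : ConvexOn ℝ {p : Matrix d d ℂ × Matrix d d ℂ | p.1.PosDef ∧ p.2.PosDef} (pairGap f))
    {A B X Y : Matrix d d ℂ} (hA : A.PosDef) (hB : B.PosDef) (hX : X.IsHermitian)
    (hY : Y.IsHermitian) :
    spectralForm (divDiff (deriv f)) (hA.add hB).isHermitian (hA.add hB).isHermitian (X + Y) ≤
      spectralForm (divDiff (deriv f)) hA.isHermitian hA.isHermitian X +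
      spectralForm (divDiff (deriv f)) hB.isHermitian hB.isHermitian Y := by
  obtain ⟨δ, hδ, hball⟩ := Metric.eventually_nhds_iff_ball.mp
    ((eventually_posDef_add_smul hA hX).and (eventually_posDef_add_smul hB hY))
  have hconv : ConvexOn ℝ (Metric.ball (0 : ℝ) δ)
      (fun t : ℝ => pairGap f (A + t • X, B + t • Y)) := by
    refine ⟨convex_ball 0 δ, fun s hs t ht a b ha hb hab => ?_⟩
    have h := H.2 (x := (A + s • X, B + s • Y)) (y := (A + t • X, B + t • Y))
      (hball s hs) (hball t ht) ha hb hab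
    have e (P Q : Matrix d d ℂ) :
        a • (P + s • Q) + b • (P + t • Q) = P + (a • s + b • t) • Q := by
      have : P = (a + b) • P := by rw [hab, one_smul]
      conv_rhs => rw [this]
      simp only [smul_add, add_smul, smul_smul, smul_eq_mul]
      abel
    simpa only [Prod.smul_mk, Prod.mk_add_mk, e] using h
  have hD : ∀ t ∈ Metric.ball (0 : ℝ) δ, _ := fun t ht =>
    hasDerivAt_pairGap hf hd hg hg' (hball t ht).1 (hball t ht).2 hX hY
  have hmono : MonotoneOn (fun t : ℝ => (trace (X * matFn (deriv f) (A + t • X))).re +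
      (trace (Y * matFn (deriv f) (B + t • Y))).re
      - (trace ((X + Y) * matFn (deriv f) (A + B + t • (X + Y)))).re) (Metric.ball (0 : ℝ) δ) :=
    (hconv.monotoneOn_deriv fun t ht => (hD t ht).differentiableAt).congr
      fun t ht => (hD t ht).deriv
  have h0 : (0 : ℝ) ∈ Metric.ball (0 : ℝ) δ := Metric.mem_ball_self hδ
  have hA0 : (A + (0 : ℝ) • X).PosDef := by simpa using hA
  have hB0 : (B + (0 : ℝ) • Y).PosDef := by simpa using hB
  have hAB0 : (A + B + (0 : ℝ) • (X + Y)).PosDef := by simpa using hA.add hB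
  have h := (hasDerivAt_deriv_pairGap hg hg' hA0 hB0 hAB0 hX hY).hasDerivWithinAt
    (s := Metric.ball (0 : ℝ) δ)
  have h' := h.nonneg_of_monotoneOn
    (Metric.isOpen_ball.uniqueDiffWithinAt (𝕜 := ℝ) h0).accPt hmono
  rw [sub_nonneg] at h'
  simpa only [zero_smul, add_zero] using h'

end Convexity

lemma subentropicOfOrder_two_iff {f : ℝ → ℝ} (hf : ConvexOn ℝ (Set.Ioi 0) f) :
    SubentropicOfOrder f 2 ↔ ∀ n : ℕ, ConvexOn ℝ
      {p : Matrix (Fin n) (Fin n) ℂ × Matrix (Fin n) (Fin n) ℂ | p.1.PosDef ∧ p.2.PosDef}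
      (pairGap f) := by
  refine ⟨fun h n => ⟨convex_setOf_posDef_pair, ?_⟩, fun h => ⟨hf, fun n => ?_⟩⟩
  · rintro ⟨A, B⟩ ⟨hA, hB⟩ ⟨A', B'⟩ ⟨hA', hB'⟩ a b ha hb hab
    have h1 : ∀ i, (![A, B] i).PosDef := by simp [Fin.forall_fin_two, hA, hB]
    have h2 : ∀ i, (![A', B'] i).PosDef := by simp [Fin.forall_fin_two, hA', hB']
    have := (h.2 n).2 h1 h2 ha hb hab
    simp [Fin.sum_univ_two] at this
    simp [pairGap]
    linarith
  · have h1 := (h n).comp_linearMap ((LinearMap.proj 0).prod (LinearMap.proj 1) :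
      (Fin 2 → Matrix (Fin n) (Fin n) ℂ) →ₗ[ℝ] _)
    have hs : {ρ : Fin 2 → Matrix (Fin n) (Fin n) ℂ | ∀ i, (ρ i).PosDef} =
        {ρ | (ρ 0).PosDef ∧ (ρ 1).PosDef} := by simp only [Fin.forall_fin_two]
    rw [hs]
    refine h1.congr fun ρ _ => ?_
    simp [Fin.sum_univ_two, pairGap]
    ring

lemma convex_setOf_forall_posDef (n k : ℕ) :
    Convex ℝ {ρ : Fin k → Matrix (Fin n) (Fin n) ℂ | ∀ i, (ρ i).PosDef} :=
  fun _ hp _ hq _ _ ha hb hab i => posDef_smul_add_smul (hp i) (hq i) ha hb hab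

lemma SubentropicOfOrder.subentropic {f : ℝ → ℝ} (h : SubentropicOfOrder f 2) :
    Subentropic f := by
  have hpair := (subentropicOfOrder_two_iff h.1).mp h
  have zero_case : ∀ n, ConvexOn ℝ {ρ : Fin 0 → Matrix (Fin n) (Fin n) ℂ | ∀ i, (ρ i).PosDef}
      (fun ρ => - trFn f (∑ i, ρ i) + ∑ i, trFn f (ρ i)) := fun n => by
    simpa using convexOn_const (- trFn f (0 : Matrix (Fin n) (Fin n) ℂ))
      (convex_setOf_forall_posDef n 0)
  have succ_case : ∀ k n, ConvexOn ℝ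
      {ρ : Fin (k + 1) → Matrix (Fin n) (Fin n) ℂ | ∀ i, (ρ i).PosDef}
      (fun ρ => - trFn f (∑ i, ρ i) + ∑ i, trFn f (ρ i)) := by
    intro k n
    induction k with
    | zero => simpa using convexOn_const (0 : ℝ) (convex_setOf_forall_posDef n 1)
    | succ k ih =>
      let init : (Fin (k + 2) → Matrix (Fin n) (Fin n) ℂ) →ₗ[ℝ]
          (Fin (k + 1) → Matrix (Fin n) (Fin n) ℂ) := LinearMap.funLeft ℝ _ Fin.castSucc
      let split : (Fin (k + 2) → Matrix (Fin n) (Fin n) ℂ) →ₗ[ℝ]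
          Matrix (Fin n) (Fin n) ℂ × Matrix (Fin n) (Fin n) ℂ :=
        LinearMap.prod ((∑ i : Fin (k + 1), LinearMap.proj i).comp init)
          (LinearMap.proj (Fin.last (k + 1)))
      have h1 := (ih.comp_linearMap init).subset
        (fun ρ (hρ : ∀ i, (ρ i).PosDef) i => hρ i.castSucc) (convex_setOf_forall_posDef n (k + 2))
      have hsplit (ρ : Fin (k + 2) → Matrix (Fin n) (Fin n) ℂ) :
          split ρ = (∑ i : Fin (k + 1), ρ i.castSucc, ρ (Fin.last (k + 1))) := by
        simp [split, init, LinearMap.funLeft]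
      have h2 := ((hpair n).comp_linearMap split).subset
        (fun ρ (hρ : ∀ i, (ρ i).PosDef) => by
          rw [Set.mem_preimage, hsplit]
          exact ⟨posDef_sum Finset.univ_nonempty fun i _ => hρ i.castSucc, hρ _⟩)
        (convex_setOf_forall_posDef n (k + 2))
      refine (h1.add h2).congr fun ρ _ => ?_
      simp only [Pi.add_apply, Function.comp_apply, hsplit, pairGap,
        Fin.sum_univ_castSucc (n := k + 1), init, LinearMap.funLeft_apply]
      ring
  rintro (_ | k)
  · exact ⟨h.1, zero_case⟩
  · exact ⟨h.1, succ_case k⟩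

/-- A twice continuously differentiable function with strictly positive
second derivative is subentropic iff `(df'(ρ+σ))⁻¹ ≥ (df'(ρ))⁻¹ + (df'(σ))⁻¹` for all
positive definite `ρ`, `σ` on any finite-dimensional Hilbert space. -/
theorem subentropic_iff_inverse_frechet_superadditive (f : ℝ → ℝ)
    (hf : ContDiffOn ℝ 2 f (Set.Ioi 0))
    (hf'' : ∀ t > (0 : ℝ), 0 < deriv (deriv f) t) :
    Subentropic f ↔
      ∀ n : ℕ, ∀ ρ σ : Matrix (Fin n) (Fin n) ℂ, ρ.PosDef → σ.PosDef →
        endLE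
          (Ring.inverse (frechetDiff (deriv f) ρ) + Ring.inverse (frechetDiff (deriv f) σ))
          (Ring.inverse (frechetDiff (deriv f) (ρ + σ))) := by
  have hf1 : ContDiffOn ℝ 1 (deriv f) (Set.Ioi 0) :=
    hf.deriv_of_isOpen isOpen_Ioi (by norm_num)
  have hd : ∀ x > 0, DifferentiableAt ℝ f x := fun x hx =>
    (hf.differentiableOn two_ne_zero).differentiableAt (Ioi_mem_nhds hx)
  have hg : ∀ x > 0, DifferentiableAt ℝ (deriv f) x := fun x hx =>
    (hf1.differentiableOn one_ne_zero).differentiableAt (Ioi_mem_nhds hx)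
  have hg' : ContinuousOn (deriv (deriv f)) (Set.Ioi 0) :=
    hf1.continuousOn_deriv_of_isOpen isOpen_Ioi le_rfl
  have hconv : ConvexOn ℝ (Set.Ioi 0) f :=
    convexOn_of_deriv2_nonneg' (convex_Ioi 0) (hf.differentiableOn two_ne_zero)
      (hf1.differentiableOn one_ne_zero) fun x hx => (hf'' x hx).le
  have hpos {n : ℕ} {ρ : Matrix (Fin n) (Fin n) ℂ} (hρ : ρ.PosDef) :=
    isPositiveEnd_frechetDiff hf1.continuousOn hf'' hρ
  have hunit {n : ℕ} {ρ : Matrix (Fin n) (Fin n) ℂ} (hρ : ρ.PosDef) :=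
    isUnit_frechetDiff hf1.continuousOn hf'' hρ
  have hquad {n : ℕ} {ρ : Matrix (Fin n) (Fin n) ℂ} (hρ : ρ.PosDef) (x) :=
    re_trace_star_mul_frechetDiff (deriv f) hρ.isHermitian x
  constructor
  · intro h n ρ σ hρ hσ
    rw [← (hpos hρ).le_add_iff_endLE_inverse (hpos hσ) (hpos (hρ.add hσ)) (hunit hρ) (hunit hσ)
      (hunit (hρ.add hσ))]
    refine (hpos hρ).le_add_of_isHermitian (hpos hσ) (hpos (hρ.add hσ)) fun x y hx hy => ?_
    rw [hquad hρ, hquad hσ, hquad (hρ.add hσ)]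
    exact spectralForm_le_of_convexOn_pairGap hconv hd hg hg'
      ((subentropicOfOrder_two_iff hconv).mp (h 2) n) hρ hσ hx hy
  · intro H
    refine ((subentropicOfOrder_two_iff hconv).mpr fun n =>
      convexOn_pairGap hconv hd hg hg' fun ρ σ hρ hσ x y _ _ => ?_).subentropic
    have h := ((hpos hρ).le_add_iff_endLE_inverse (hpos hσ) (hpos (hρ.add hσ)) (hunit hρ)
      (hunit hσ) (hunit (hρ.add hσ))).mpr (H n ρ σ hρ hσ) x y
    rwa [hquad hρ, hquad hσ, hquad (hρ.add hσ)] at h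

end
end
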